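/- arXiv:2101.11886 — 5 statements merged into one kernel-verified Lean document; each statement's English description precedes it below -/
import Mathlib

section
/- For any n, p ∈ ℕ and any family A ⊆ 2^{[n]}, |C^p[A]| ≤ |C^p[I_{|A|}]|; that is, among all families of a given size, the initial segment of the simplicial ordering maximizes the number of sets at symmetric-difference distance at most p from every member of the family. -/
open Finset

/-- Strict simplicial order on subsets of `[n]` (as `Finset (Fin n)`):
`x` precedes `y` iff `|x| < |y|`, or `|x| = |y|` and `min (x ∆ y) ∈ x`. -/
def SimpLT {n : ℕ} (x y : Finset (Fin n)) : Prop :=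
  x.card < y.card ∨
    (x.card = y.card ∧ ∃ i, i ∈ x ∧ i ∉ y ∧ ∀ j ∈ symmDiff x y, i ≤ j)

instance {n : ℕ} (x y : Finset (Fin n)) : Decidable (SimpLT x y) := by
  unfold SimpLT; infer_instance

/-- `ISeg n m` : the initial segment consisting of the first `m` subsets of `[n]`
in the simplicial ordering (the sets having fewer than `m` strict predecessors). -/
def ISeg (n m : ℕ) : Finset (Finset (Fin n)) :=
  Finset.univ.filter fun x => (Finset.univ.filter fun z => SimpLT z x).card < m

/-- `Cball n p A` : the set `C^p[A]` of all subsets of `[n]` at symmetric-difference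
distance at most `p` from every member of `A`. -/
def Cball (n p : ℕ) (A : Finset (Finset (Fin n))) : Finset (Finset (Fin n)) :=
  Finset.univ.filter fun y => ∀ x ∈ A, (symmDiff x y).card ≤ p

/-- `Cpunct n p A` : the set `C^p(A) = C^p[A] \ A`. -/
def Cpunct (n p : ℕ) (A : Finset (Finset (Fin n))) : Finset (Finset (Fin n)) :=
  Cball n p A \ A

/-- The `p`-th power of the hypercube `Q_n`: vertices are subsets of `[n]`,
adjacent iff the symmetric difference has size between `1` and `p`. -/
def cubePow (n p : ℕ) : SimpleGraph (Finset (Fin n)) where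
  Adj x y := 1 ≤ (symmDiff x y).card ∧ (symmDiff x y).card ≤ p
  symm := ⟨fun x y h => by simpa [symmDiff_comm] using h⟩
  loopless := ⟨fun x h => by simp [symmDiff_self] at h⟩

/-- `G` admits a b-coloring with `k` colors: a proper coloring with colors `Fin k`
such that every color class contains a vertex having a neighbor in each other
color class. -/
def HasBColoring {V : Type*} (G : SimpleGraph V) (k : ℕ) : Prop :=
  ∃ c : V → Fin k,
    (∀ x y, G.Adj x y → c x ≠ c y) ∧
    (∀ i : Fin k, ∃ v, c v = i ∧ ∀ j : Fin k, j ≠ i → ∃ w, G.Adj v w ∧ c w = j)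

/-- The `p`-th power of the Hamming graph `H_{n,q}`: vertices are `q`-ary `n`-tuples,
adjacent iff their Hamming distance is between `1` and `p`. -/
def hammingPow (n q p : ℕ) : SimpleGraph (Fin n → ZMod q) where
  Adj x y := 1 ≤ hammingDist x y ∧ hammingDist x y ≤ p
  symm := ⟨fun x y h => by simpa [hammingDist_comm] using h⟩
  loopless := ⟨fun x h => by simp at h⟩


namespace SimpLT

variable {n : ℕ} {x y z : Finset (Fin n)}

theorem iff_forall_lt : SimpLT x y ↔ x.card < y.card ∨
    (x.card = y.card ∧ ∃ i, i ∈ x ∧ i ∉ y ∧ ∀ j < i, (j ∈ x ↔ j ∈ y)) := by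
  unfold SimpLT
  refine or_congr_right (and_congr_right fun _ => exists_congr fun i =>
    and_congr_right fun _ => and_congr_right fun _ => forall_congr' fun j => ?_)
  rw [mem_symmDiff]
  constructor
  · intro h hj
    by_contra hc
    exact absurd (h (by tauto)) (not_le.2 hj)
  · intro h hj
    by_contra hc
    have := h (not_le.1 hc)
    tauto

theorem irrefl (x : Finset (Fin n)) : ¬ SimpLT x x := by
  rw [iff_forall_lt]; grind

theorem trans (hxy : SimpLT x y) (hyz : SimpLT y z) : SimpLT x z := by
  rw [iff_forall_lt] at *
  rcases hxy with h | ⟨h, i, hix, hiy, hi⟩ <;> rcases hyz with h' | ⟨h', j, hjy, hjz, hj⟩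
  · left; omega
  · left; omega
  · left; omega
  · right
    refine ⟨h.trans h', ?_⟩
    rcases lt_trichotomy i j with hij | rfl | hij
    · exact ⟨i, hix, by grind, by grind⟩
    · exact absurd hjy hiy
    · exact ⟨j, by grind, hjz, by grind⟩

theorem total (h : x ≠ y) : SimpLT x y ∨ SimpLT y x := by
  rcases lt_trichotomy x.card y.card with hc | hc | hc
  · exact Or.inl (Or.inl hc)
  · have hne : (symmDiff x y).Nonempty := by
      rw [nonempty_iff_ne_empty]
      simpa [symmDiff_eq_bot, ← bot_eq_empty] using h
    have hmin := min'_mem _ hne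
    rcases mem_symmDiff.1 hmin with ⟨h1, h2⟩ | ⟨h1, h2⟩
    · exact Or.inl (Or.inr ⟨hc, _, h1, h2, fun j hj => min'_le _ _ hj⟩)
    · exact Or.inr (Or.inr ⟨hc.symm, _, h1, h2, fun j hj => min'_le _ _ (by rwa [symmDiff_comm])⟩)
  · exact Or.inr (Or.inl hc)

theorem insert_iff {a : Fin n} (hx : a ∉ x) (hy : a ∉ y) :
    SimpLT (insert a x) (insert a y) ↔ SimpLT x y := by
  rw [iff_forall_lt, iff_forall_lt, card_insert_of_notMem hx, card_insert_of_notMem hy]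
  refine or_congr (by omega) (and_congr (by omega) (exists_congr fun i => ?_))
  by_cases hi : i = a
  · subst hi; simp [hx]
  · simp only [mem_insert, hi, false_or]
    refine and_congr_right fun _ => and_congr_right fun _ => forall_congr' fun j => ?_
    by_cases hj : j = a
    · subst hj; simp [hx, hy]
    · simp [hj]

end SimpLT

namespace Harper

variable {n : ℕ} {S : Finset (Fin n)} {A B I J : Finset (Finset (Fin n))} {a : Fin n}

/-- `I` is an initial segment of the simplicial order on the subsets of `S`. -/
def IsInit (S : Finset (Fin n)) (I : Finset (Finset (Fin n))) : Prop :=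
  I ⊆ S.powerset ∧ ∀ y ∈ I, ∀ x ⊆ S, SimpLT x y → x ∈ I

/-- The number of subsets of `S` preceding `x`. -/
def rank (S x : Finset (Fin n)) : ℕ := (S.powerset.filter fun z => SimpLT z x).card

/-- The first `m` subsets of `S` in the simplicial order. -/
def seg (S : Finset (Fin n)) (m : ℕ) : Finset (Finset (Fin n)) :=
  S.powerset.filter fun x => rank S x < m

/-- The closed neighbourhood of `A` in the hypercube of subsets of `S`. -/
def nhd (S : Finset (Fin n)) (A : Finset (Finset (Fin n))) : Finset (Finset (Fin n)) :=
  S.powerset.filter fun w => w ∈ A ∨ ∃ i ∈ S, w.erase i ∈ A ∨ insert i w ∈ A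

theorem mem_nhd {w : Finset (Fin n)} :
    w ∈ nhd S A ↔ w ⊆ S ∧ (w ∈ A ∨ ∃ i ∈ S, w.erase i ∈ A ∨ insert i w ∈ A) := by
  simp [nhd]

theorem nhd_mono (h : A ⊆ B) : nhd S A ⊆ nhd S B := by
  intro w
  rw [mem_nhd, mem_nhd]
  rintro ⟨hw, h1 | ⟨i, hi, h1 | h1⟩⟩
  · exact ⟨hw, Or.inl (h h1)⟩
  · exact ⟨hw, Or.inr ⟨i, hi, Or.inl (h h1)⟩⟩
  · exact ⟨hw, Or.inr ⟨i, hi, Or.inr (h h1)⟩⟩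

theorem rank_lt_rank {x y : Finset (Fin n)} (hx : x ⊆ S) (h : SimpLT x y) :
    rank S x < rank S y := by
  refine card_lt_card (ssubset_iff_of_subset ?_ |>.2 ⟨x, ?_, ?_⟩)
  · exact fun z hz => by
      rw [mem_filter] at hz ⊢
      exact ⟨hz.1, hz.2.trans h⟩
  · simp [hx, h]
  · simp [SimpLT.irrefl]

theorem rank_injOn : Set.InjOn (rank S) (S.powerset : Set (Finset (Fin n))) := by
  intro x hx y hy h
  by_contra hne
  simp only [mem_coe, mem_powerset] at hx hy
  rcases SimpLT.total hne with hl | hl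
  · exact (rank_lt_rank hx hl).ne h
  · exact (rank_lt_rank hy hl).ne h.symm

theorem rank_lt {x : Finset (Fin n)} (hx : x ⊆ S) : rank S x < S.powerset.card := by
  refine card_lt_card (ssubset_iff_of_subset (filter_subset _ _) |>.2 ⟨x, ?_, ?_⟩)
  · simpa using hx
  · simp [SimpLT.irrefl]

theorem image_rank : S.powerset.image (rank S) = range S.powerset.card := by
  refine eq_of_subset_of_card_le (fun k hk => ?_) ?_
  · obtain ⟨x, hx, rfl⟩ := mem_image.1 hk
    exact mem_range.2 (rank_lt (mem_powerset.1 hx))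
  · rw [card_image_of_injOn rank_injOn, card_range]

theorem isInit_seg (S : Finset (Fin n)) (m : ℕ) : IsInit S (seg S m) := by
  refine ⟨filter_subset _ _, fun y hy x hx h => ?_⟩
  rw [seg, mem_filter] at hy ⊢
  exact ⟨mem_powerset.2 hx, (rank_lt_rank hx h).trans hy.2⟩

theorem card_seg {m : ℕ} (hm : m ≤ S.powerset.card) : (seg S m).card = m := by
  have h : (seg S m).image (rank S) = range m := by
    ext k
    simp only [seg, mem_image, mem_filter, mem_range]
    constructor
    · rintro ⟨x, ⟨_, hx⟩, rfl⟩; exact hx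
    · intro hk
      have : k ∈ S.powerset.image (rank S) := by
        rw [image_rank, mem_range]; omega
      obtain ⟨x, hx, rfl⟩ := mem_image.1 this
      exact ⟨x, ⟨hx, hk⟩, rfl⟩
  rw [← card_image_of_injOn (rank_injOn.mono (coe_subset.2 (isInit_seg S m).1)), h, card_range]

theorem IsInit.subset_or_subset (hI : IsInit S I) (hJ : IsInit S J) : I ⊆ J ∨ J ⊆ I := by
  by_contra! h
  obtain ⟨x, hxI, hxJ⟩ := not_subset.1 h.1
  obtain ⟨y, hyJ, hyI⟩ := not_subset.1 h.2
  have hne : x ≠ y := by rintro rfl; exact hxJ hyJ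
  rcases SimpLT.total hne with hl | hl
  · exact hxJ (hJ.2 y hyJ x (mem_powerset.1 (hI.1 hxI)) hl)
  · exact hyI (hI.2 x hxI y (mem_powerset.1 (hJ.1 hyJ)) hl)

theorem IsInit.subset_of_card_le (hI : IsInit S I) (hJ : IsInit S J) (h : I.card ≤ J.card) :
    I ⊆ J := by
  rcases hI.subset_or_subset hJ with h' | h'
  · exact h'
  · exact (eq_of_subset_of_card_le h' h).ge

theorem IsInit.eq_of_card_eq (hI : IsInit S I) (hJ : IsInit S J) (h : I.card = J.card) :
    I = J :=
  eq_of_subset_of_card_le (hI.subset_of_card_le hJ h.le) h.ge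

/-- Among families of a given size, an initial segment minimizes the sum of a monotone weight. -/
theorem IsInit.sum_lt_sum (hI : IsInit S I) (hA : A ⊆ S.powerset) (hc : I.card = A.card)
    (hne : I ≠ A) (r : Finset (Fin n) → ℕ)
    (hr : ∀ x y, x ⊆ S → y ⊆ S → SimpLT x y → r x < r y) : ∑ x ∈ I, r x < ∑ x ∈ A, r x := by
  have hcard : (I \ A).card = (A \ I).card := card_sdiff_comm hc
  have hnon : (I \ A).Nonempty := by
    rw [sdiff_nonempty]
    exact fun h => hne (eq_of_subset_of_card_le h hc.ge)
  have hlt : ∀ x ∈ I \ A, ∀ y ∈ A \ I, r x < r y := by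
    intro x hx y hy
    rw [mem_sdiff] at hx hy
    have hxS := mem_powerset.1 (hI.1 hx.1)
    have hyS := mem_powerset.1 (hA hy.1)
    have hxy : x ≠ y := by rintro rfl; exact hx.2 hy.1
    rcases SimpLT.total hxy with hl | hl
    · exact hr x y hxS hyS hl
    · exact absurd (hI.2 x hx.1 y hyS hl) hy.2
  obtain ⟨e⟩ : Nonempty ((I \ A : Finset _) ≃ (A \ I : Finset _)) :=
    ⟨equivOfCardEq hcard⟩
  have key : ∑ x ∈ I \ A, r x < ∑ x ∈ A \ I, r x := by
    rw [← sum_coe_sort (I \ A), ← sum_coe_sort (A \ I), ← Equiv.sum_comp e]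
    have : Nonempty (I \ A : Finset _) := hnon.to_subtype
    exact sum_lt_sum_of_nonempty univ_nonempty fun x _ => hlt x x.2 _ (e x).2
  have h1 := sum_sdiff (f := r) (inter_subset_left : I ∩ A ⊆ I)
  have h2 := sum_sdiff (f := r) (inter_subset_right : I ∩ A ⊆ A)
  rw [sdiff_inter_self_left] at h1
  rw [sdiff_inter_self_right] at h2
  omega

theorem IsInit.nhd (hI : IsInit S I) : IsInit S (nhd S I) := by
  refine ⟨filter_subset _ _, fun w hw v hv hlt => ?_⟩
  rw [mem_nhd] at hw ⊢
  refine ⟨hv, ?_⟩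
  obtain ⟨hwS, hw⟩ := hw
  by_cases hvI : v ∈ I
  · exact Or.inl hvI
  right
  have hlow : ∀ z ∈ I, ∀ x ⊆ S, x.card < z.card → x ∈ I :=
    fun z hz x hx h => hI.2 z hz x hx (Or.inl h)
  have hwI : w ∉ I := fun h => hvI (hI.2 w h v hv hlt)
  obtain ⟨i, hiS, hi⟩ : ∃ i ∈ w, w.erase i ∈ I := by
    rcases hw with h | ⟨i, hi, h | h⟩
    · exact absurd h hwI
    · by_cases hiw : i ∈ w
      · exact ⟨i, hiw, h⟩
      · rw [erase_eq_of_notMem hiw] at h; exact absurd h hwI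
    · by_cases hiw : i ∈ w
      · rw [insert_eq_of_mem hiw] at h; exact absurd h hwI
      · exact absurd (hlow _ h w hwS (by rw [card_insert_of_notMem hiw]; omega)) hwI
  have hcw := card_erase_add_one hiS
  have hve : v.Nonempty := by
    rw [nonempty_iff_ne_empty]
    rintro rfl
    rcases Nat.eq_zero_or_pos (w.erase i).card with h0 | h0
    · rw [card_eq_zero] at h0; rw [h0] at hi; exact hvI hi
    · exact hvI (hlow _ hi _ hv (by simpa using h0))
  set j := v.max' hve with hj
  have hjv : j ∈ v := max'_mem _ _
  have hcv := card_erase_add_one hjv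
  have hmax : ∀ k ∈ v, k ≤ j := fun k hk => le_max' _ _ hk
  refine ⟨j, hv hjv, Or.inl ?_⟩
  have hveS : v.erase j ⊆ S := (erase_subset _ _).trans hv
  rw [SimpLT.iff_forall_lt] at hlt
  rcases hlt with hc | ⟨hc, m, hmv, hmw, hm⟩
  · exact hlow _ hi _ hveS (by omega)
  by_cases heq : v.erase j = w.erase i
  · rwa [heq]
  refine hI.2 _ hi _ hveS (SimpLT.iff_forall_lt.2 (Or.inr ⟨by omega, ?_⟩))
  have him : i ≠ m := by rintro rfl; exact hmw hiS
  rcases lt_or_gt_of_ne him with hlt | hlt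
  · exact ⟨i, by grind, by grind, by grind⟩
  · rcases (hmax m hmv).lt_or_eq with hmj | hmj
    · exact ⟨m, by grind, by grind, by grind⟩
    · exact absurd (eq_of_subset_of_card_le (fun k hk => by grind) (by omega)) heq

theorem card_nhd_eq (hA : A ⊆ S.powerset) (ha : a ∈ S) :
    (nhd S A).card =
      (nhd (S.erase a) (A.nonMemberSubfamily a) ∪ A.memberSubfamily a).card +
      (nhd (S.erase a) (A.memberSubfamily a) ∪ A.nonMemberSubfamily a).card := by
  rw [← card_memberSubfamily_add_card_nonMemberSubfamily a (nhd S A), add_comm]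
  congr 2
  · ext w
    simp only [mem_nonMemberSubfamily, mem_nhd, mem_union, mem_memberSubfamily]
    constructor
    · rintro ⟨⟨hw, h⟩, haw⟩
      have hwe : w ⊆ S.erase a := subset_erase.2 ⟨hw, haw⟩
      rcases h with h | ⟨i, hi, h⟩
      · grind
      · by_cases hia : i = a
        · subst hia
          rw [erase_eq_of_notMem haw] at h
          grind
        · left
          exact ⟨hwe, Or.inr ⟨i, by grind, by grind⟩⟩
    · rintro (⟨hw, h⟩ | ⟨h, haw⟩)
      · refine ⟨⟨hw.trans (erase_subset _ _), ?_⟩, fun h => by simpa using hw h⟩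
        rcases h with h | ⟨i, hi, h⟩
        · exact Or.inl h.1
        · exact Or.inr ⟨i, by grind, by grind⟩
      · exact ⟨⟨(subset_insert _ _).trans (mem_powerset.1 (hA h)),
          Or.inr ⟨a, ha, Or.inr h⟩⟩, haw⟩
  · ext w
    simp only [mem_nonMemberSubfamily, mem_nhd, mem_union, mem_memberSubfamily]
    constructor
    · rintro ⟨⟨hw, h⟩, haw⟩
      have hwe : w ⊆ S.erase a := subset_erase.2 ⟨(subset_insert _ _).trans hw, haw⟩
      rcases h with h | ⟨i, hi, h⟩
      · grind
      · by_cases hia : i = a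
        · subst hia
          rw [erase_insert haw, insert_idem] at h
          grind
        · left
          refine ⟨hwe, Or.inr ⟨i, by grind, ?_⟩⟩
          rw [erase_insert_of_ne (Ne.symm hia), insert_comm] at h
          grind
    · rintro (⟨hw, h⟩ | ⟨h, haw⟩)
      · have haw : a ∉ w := fun h => by simpa using hw h
        refine ⟨⟨insert_subset ha (hw.trans (erase_subset _ _)), ?_⟩, haw⟩
        rcases h with h | ⟨i, hi, h⟩
        · exact Or.inl h.1
        · refine Or.inr ⟨i, by grind, ?_⟩
          have hia : i ≠ a := by grind
          rw [erase_insert_of_ne (Ne.symm hia), insert_comm]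
          grind
      · refine ⟨⟨insert_subset ha (mem_powerset.1 (hA h)), Or.inr ⟨a, ha, Or.inl ?_⟩⟩, haw⟩
        rwa [erase_insert haw]

theorem nonMemberSubfamily_subset_powerset (hA : A ⊆ S.powerset) :
    A.nonMemberSubfamily a ⊆ (S.erase a).powerset := by
  intro w hw
  rw [mem_nonMemberSubfamily] at hw
  exact mem_powerset.2 (subset_erase.2 ⟨mem_powerset.1 (hA hw.1), hw.2⟩)

theorem memberSubfamily_subset_powerset (hA : A ⊆ S.powerset) :
    A.memberSubfamily a ⊆ (S.erase a).powerset := by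
  intro w hw
  rw [mem_memberSubfamily] at hw
  exact mem_powerset.2 (subset_erase.2
    ⟨(subset_insert _ _).trans (mem_powerset.1 (hA hw.1)), hw.2⟩)

/-- Replace both `a`-sections of `A` by initial segments of the same sizes. -/
def compress (S : Finset (Fin n)) (a : Fin n) (A : Finset (Finset (Fin n))) :
    Finset (Finset (Fin n)) :=
  seg (S.erase a) (A.nonMemberSubfamily a).card ∪
    (seg (S.erase a) (A.memberSubfamily a).card).image (insert a)

theorem notMem_of_mem_seg_erase {m : ℕ} {w : Finset (Fin n)} (hw : w ∈ seg (S.erase a) m) :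
    a ∉ w := fun h => by simpa using mem_powerset.1 ((isInit_seg _ _).1 hw) h

theorem nonMemberSubfamily_compress : (compress S a A).nonMemberSubfamily a =
    seg (S.erase a) (A.nonMemberSubfamily a).card := by
  rw [compress, nonMemberSubfamily_union, nonMemberSubfamily_image_insert, union_empty]
  ext w
  rw [mem_nonMemberSubfamily]
  exact ⟨fun h => h.1, fun h => ⟨h, notMem_of_mem_seg_erase h⟩⟩

theorem memberSubfamily_compress : (compress S a A).memberSubfamily a =
    seg (S.erase a) (A.memberSubfamily a).card := by
  rw [compress, memberSubfamily_union,
    memberSubfamily_image_insert fun w hw => notMem_of_mem_seg_erase hw]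
  convert empty_union _
  ext w
  simp only [mem_memberSubfamily, notMem_empty, iff_false, not_and]
  exact fun h => absurd (mem_insert_self a w) (notMem_of_mem_seg_erase h)

theorem compress_subset_powerset (ha : a ∈ S) : compress S a A ⊆ S.powerset := by
  intro w hw
  rw [compress, mem_union, mem_image] at hw
  rw [mem_powerset]
  rcases hw with h | ⟨w, h, rfl⟩
  · exact (mem_powerset.1 ((isInit_seg _ _).1 h)).trans (erase_subset _ _)
  · exact insert_subset ha ((mem_powerset.1 ((isInit_seg _ _).1 h)).trans (erase_subset _ _))

theorem card_seg_nonMember (hA : A ⊆ S.powerset) :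
    (seg (S.erase a) (A.nonMemberSubfamily a).card).card = (A.nonMemberSubfamily a).card :=
  card_seg (card_le_card (nonMemberSubfamily_subset_powerset hA))

theorem card_seg_member (hA : A ⊆ S.powerset) :
    (seg (S.erase a) (A.memberSubfamily a).card).card = (A.memberSubfamily a).card :=
  card_seg (card_le_card (memberSubfamily_subset_powerset hA))

theorem card_compress (hA : A ⊆ S.powerset) : (compress S a A).card = A.card := by
  rw [← card_memberSubfamily_add_card_nonMemberSubfamily a, memberSubfamily_compress,
    nonMemberSubfamily_compress, card_seg_nonMember hA, card_seg_member hA,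
    card_memberSubfamily_add_card_nonMemberSubfamily]

theorem sum_eq_sum_sections (r : Finset (Fin n) → ℕ) (a : Fin n) (A : Finset (Finset (Fin n))) :
    ∑ x ∈ A, r x = ∑ x ∈ A.nonMemberSubfamily a, r x +
      ∑ x ∈ A.memberSubfamily a, r (insert a x) := by
  rw [← sum_filter_add_sum_filter_not A (fun x => a ∉ x)]
  congr 1
  rw [memberSubfamily, sum_image ((erase_injOn' a).mono (by simp))]
  refine sum_congr (by simp) fun x hx => ?_
  rw [insert_erase (mem_filter.1 hx).2]

theorem IsInit.sum_le_sum (hI : IsInit S I) (hA : A ⊆ S.powerset) (hc : I.card = A.card)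
    (r : Finset (Fin n) → ℕ)
    (hr : ∀ x y, x ⊆ S → y ⊆ S → SimpLT x y → r x < r y) : ∑ x ∈ I, r x ≤ ∑ x ∈ A, r x := by
  by_cases h : I = A
  · rw [h]
  · exact (hI.sum_lt_sum hA hc h r hr).le

theorem sum_rank_compress_lt (hA : A ⊆ S.powerset) (ha : a ∈ S)
    (h : ¬ (IsInit (S.erase a) (A.nonMemberSubfamily a) ∧
      IsInit (S.erase a) (A.memberSubfamily a))) :
    ∑ x ∈ compress S a A, rank S x < ∑ x ∈ A, rank S x := by
  rw [sum_eq_sum_sections _ a, sum_eq_sum_sections _ a A, nonMemberSubfamily_compress,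
    memberSubfamily_compress]
  have hsub : ∀ {x : Finset (Fin n)}, x ⊆ S.erase a → x ⊆ S :=
    fun h => h.trans (erase_subset _ _)
  have hna : ∀ {x : Finset (Fin n)}, x ⊆ S.erase a → a ∉ x := fun h h' => by simpa using h h'
  have hr0 : ∀ x y, x ⊆ S.erase a → y ⊆ S.erase a → SimpLT x y → rank S x < rank S y :=
    fun x y hx hy h => rank_lt_rank (hsub hx) h
  have hr1 : ∀ x y, x ⊆ S.erase a → y ⊆ S.erase a → SimpLT x y →
      rank S (insert a x) < rank S (insert a y) := fun x y hx hy h =>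
    rank_lt_rank (insert_subset ha (hsub hx)) ((SimpLT.insert_iff (hna hx) (hna hy)).2 h)
  have hi0 := isInit_seg (S.erase a) (A.nonMemberSubfamily a).card
  have hi1 := isInit_seg (S.erase a) (A.memberSubfamily a).card
  by_cases h0 : IsInit (S.erase a) (A.nonMemberSubfamily a)
  · refine add_lt_add_of_le_of_lt (hi0.sum_le_sum (nonMemberSubfamily_subset_powerset hA)
      (card_seg_nonMember hA) _ hr0) (hi1.sum_lt_sum (memberSubfamily_subset_powerset hA)
      (card_seg_member hA) (fun he => h ⟨h0, ?_⟩) _ hr1)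
    rwa [he] at hi1
  · refine add_lt_add_of_lt_of_le (hi0.sum_lt_sum (nonMemberSubfamily_subset_powerset hA)
      (card_seg_nonMember hA) (fun he => h0 ?_) _ hr0) (hi1.sum_le_sum
      (memberSubfamily_subset_powerset hA) (card_seg_member hA) _ hr1)
    rwa [he] at hi0

theorem card_nhd_compress_le (hA : A ⊆ S.powerset) (ha : a ∈ S)
    (ih : ∀ B I : Finset (Finset (Fin n)), B ⊆ (S.erase a).powerset → IsInit (S.erase a) I →
      I.card = B.card → (nhd (S.erase a) I).card ≤ (nhd (S.erase a) B).card) :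
    (nhd S (compress S a A)).card ≤ (nhd S A).card := by
  rw [card_nhd_eq (compress_subset_powerset ha) ha, card_nhd_eq hA ha,
    nonMemberSubfamily_compress, memberSubfamily_compress]
  have key : ∀ B C : Finset (Finset (Fin n)), B ⊆ (S.erase a).powerset →
      C ⊆ (S.erase a).powerset →
      (nhd (S.erase a) (seg (S.erase a) B.card) ∪ seg (S.erase a) C.card).card ≤
        (nhd (S.erase a) B ∪ C).card := by
    intro B C hB hC
    have hi := isInit_seg (S.erase a) B.card
    have hj := isInit_seg (S.erase a) C.card
    rcases hi.nhd.subset_or_subset hj with h | h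
    · rw [union_eq_right.2 h, card_seg (card_le_card hC)]
      exact card_le_card subset_union_right
    · rw [union_eq_left.2 h]
      exact (ih B _ hB hi (card_seg (card_le_card hB))).trans (card_le_card subset_union_left)
  exact add_le_add
    (key _ _ (nonMemberSubfamily_subset_powerset hA) (memberSubfamily_subset_powerset hA))
    (key _ _ (memberSubfamily_subset_powerset hA) (nonMemberSubfamily_subset_powerset hA))

/-- In a family all of whose sections are initial segments, the only possible inversion is between
complementary sets. -/
theorem eq_sdiff_of_sections_isInit (hA : A ⊆ S.powerset)
    (h : ∀ a ∈ S, IsInit (S.erase a) (A.nonMemberSubfamily a) ∧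
      IsInit (S.erase a) (A.memberSubfamily a)) {x y : Finset (Fin n)} (hx : x ⊆ S)
    (hxA : x ∉ A) (hyA : y ∈ A) (hxy : SimpLT x y) : y = S \ x := by
  have hy := mem_powerset.1 (hA hyA)
  ext a
  rw [mem_sdiff]
  by_cases ha : a ∈ S
  swap
  · exact ⟨fun h => absurd (hy h) ha, fun h => absurd h.1 ha⟩
  simp only [ha, true_and]
  constructor
  · intro hay hax
    have := (h a ha).2.2 (y.erase a) (by simp [insert_erase hay, hyA]) (x.erase a)
      (erase_subset_erase _ hx)
      ((SimpLT.insert_iff (notMem_erase _ _) (notMem_erase _ _)).1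
        (by rwa [insert_erase hax, insert_erase hay]))
    rw [mem_memberSubfamily, insert_erase hax] at this
    exact hxA this.1
  · intro hax
    by_contra hay
    have := (h a ha).1.2 y (by simp [hay, hyA]) x (subset_erase.2 ⟨hx, hax⟩) hxy
    exact hxA (mem_nonMemberSubfamily.1 this).1

theorem nhd_subset_of_complementary {x : Finset (Fin n)} (hx : x ⊆ S)
    (hxy : SimpLT x (S \ x)) (hyA : S \ x ∈ A)
    (hlt : ∀ z ⊆ S, SimpLT z (S \ x) → z ≠ x → z ∈ A) :
    nhd S (S.powerset.filter fun z => SimpLT z (S \ x)) ⊆ nhd S A := by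
  set y := S \ x with hy
  have hsing : x = ∅ → ∀ i ∈ S, {i} ∈ A := by
    rintro rfl i hi
    rw [sdiff_empty] at hy
    by_cases hiy : {i} = y
    · rwa [hiy]
    · have hlt' : ({i} : Finset (Fin n)).card < y.card :=
        card_lt_card (ssubset_of_subset_of_ne (by simpa [hy] using hi) hiy)
      exact hlt _ (by simpa using hi) (Or.inl hlt') (by simp)
  have hself : x ∈ nhd S A := by
    refine mem_nhd.2 ⟨hx, Or.inr ?_⟩
    rcases x.eq_empty_or_nonempty with rfl | ⟨j, hj⟩
    · rcases S.eq_empty_or_nonempty with rfl | ⟨i, hi⟩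
      · exact absurd hxy (SimpLT.irrefl _)
      · exact ⟨i, hi, Or.inr (by simpa using hsing rfl i hi)⟩
    · refine ⟨j, hx hj, Or.inl (hlt _ ((erase_subset _ _).trans hx)
        (SimpLT.trans (Or.inl (card_erase_lt_of_mem hj)) hxy) ?_)⟩
      exact fun h => notMem_erase j x (h.symm ▸ hj)
  have hJ : ∀ z ⊆ S, SimpLT z y → z ∈ nhd S A := by
    intro z hz hzy
    by_cases hzx : z = x
    · rwa [hzx]
    · exact mem_nhd.2 ⟨hz, Or.inl (hlt z hz hzy hzx)⟩
  have hins : ∀ i ∈ S, i ∉ x → insert i x ∈ nhd S A := by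
    intro i hi hix
    refine mem_nhd.2 ⟨insert_subset hi hx, ?_⟩
    have hcard : ∀ j ∈ x, ((insert i x).erase j).card = x.card := fun j hj => by
      rw [card_erase_of_mem (mem_insert_of_mem hj), card_insert_of_notMem hix,
        Nat.add_sub_cancel]
    have hne : ∀ j ∈ x, (insert i x).erase j ≠ x := fun j hj h =>
      notMem_erase j (insert i x) (h.symm ▸ hj)
    have hsub : ∀ j, (insert i x).erase j ⊆ S := fun j =>
      (erase_subset _ _).trans (insert_subset hi hx)
    rcases x.eq_empty_or_nonempty with h0 | ⟨j, hj⟩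
    · left
      simpa [h0] using hsing h0 i hi
    right
    rw [SimpLT.iff_forall_lt] at hxy
    rcases hxy with hc | ⟨hc, m, hmx, hmy, hm⟩
    · exact ⟨j, hx hj, Or.inl (hlt _ (hsub j) (Or.inl (by rwa [hcard j hj])) (hne j hj))⟩
    · by_cases hex : ∃ k ∈ x, k ≠ m
      · obtain ⟨k, hk, hkm⟩ := hex
        refine ⟨k, hx hk, Or.inl (hlt _ (hsub k) (SimpLT.iff_forall_lt.2
          (Or.inr ⟨(hcard k hk).trans hc, m, ?_, hmy, fun l hl => ?_⟩)) (hne k hk))⟩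
        · exact mem_erase.2 ⟨hkm.symm, mem_insert_of_mem hmx⟩
        · have hlS : l ∉ S := fun hlS => by
            have := hm l hl
            rw [hy, mem_sdiff] at this
            tauto
          exact ⟨fun h => absurd (hsub k h) hlS, fun h => absurd (sdiff_subset h) hlS⟩
      · push Not at hex
        have hxm : x = {m} := eq_singleton_iff_unique_mem.2 ⟨hmx, hex⟩
        refine ⟨m, hx hmx, Or.inl ?_⟩
        convert hyA
        refine eq_of_subset_of_card_le (fun k hk => ?_) (by rw [hcard m hmx, hc])
        rw [mem_erase, mem_insert] at hk
        rcases hk with ⟨hkm, rfl | hk⟩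
        · exact mem_sdiff.2 ⟨hi, hix⟩
        · exact absurd (hex k hk) hkm
  intro w hw
  simp only [mem_nhd, mem_filter, mem_powerset] at hw
  obtain ⟨hwS, hw | ⟨i, hi, hw | hw⟩⟩ := hw
  · exact hJ w hwS hw.2
  · by_cases hwx : w.erase i = x
    · by_cases hiw : i ∈ w
      · rw [← insert_erase hiw, hwx]
        exact hins i hi (hwx ▸ notMem_erase i w)
      · rw [erase_eq_of_notMem hiw] at hwx
        rwa [hwx]
    · exact mem_nhd.2 ⟨hwS, Or.inr ⟨i, hi, Or.inl (hlt _ hw.1 hw.2 hwx)⟩⟩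
  · by_cases hiw : i ∈ w
    · rw [insert_eq_of_mem hiw] at hw
      exact hJ w hwS hw.2
    · refine hJ w hwS (SimpLT.trans (Or.inl ?_) hw.2)
      rw [card_insert_of_notMem hiw]
      exact Nat.lt_succ_self _

theorem card_nhd_le_of_sections_isInit (hA : A ⊆ S.powerset)
    (h : ∀ a ∈ S, IsInit (S.erase a) (A.nonMemberSubfamily a) ∧
      IsInit (S.erase a) (A.memberSubfamily a)) (hI : IsInit S I) (hc : I.card = A.card) :
    (nhd S I).card ≤ (nhd S A).card := by
  by_cases hAi : IsInit S A
  · rw [hI.eq_of_card_eq hAi hc]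
  obtain ⟨y, hyA, x, hx, hxy, hxA⟩ : ∃ y ∈ A, ∃ x ⊆ S, SimpLT x y ∧ x ∉ A := by
    by_contra! hcon
    exact hAi ⟨hA, hcon⟩
  have key : ∀ {x y}, x ⊆ S → x ∉ A → y ∈ A → SimpLT x y → y = S \ x :=
    fun hx hxA hyA hxy => eq_sdiff_of_sections_isInit hA h hx hxA hyA hxy
  obtain rfl := key hx hxA hyA hxy
  have hlt : ∀ z ⊆ S, SimpLT z (S \ x) → z ≠ x → z ∈ A := by
    intro z hz hzy hne
    by_contra hzA
    have := key hz hzA hyA hzy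
    apply hne
    rw [← Finset.sdiff_sdiff_eq_self hx, this, Finset.sdiff_sdiff_eq_self hz]
  set J := S.powerset.filter fun z => SimpLT z (S \ x) with hJ
  have hJi : IsInit S J := by
    refine ⟨filter_subset _ _, fun y hy z hz hzy => ?_⟩
    rw [hJ, mem_filter] at hy ⊢
    exact ⟨mem_powerset.2 hz, hzy.trans hy.2⟩
  have hAJ : insert x A = insert (S \ x) J := by
    ext z
    rw [mem_insert, mem_insert, hJ, mem_filter, mem_powerset]
    constructor
    · rintro (rfl | hz)
      · exact Or.inr ⟨hx, hxy⟩
      · by_cases hzy : z = S \ x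
        · exact Or.inl hzy
        · rcases SimpLT.total hzy with hl | hl
          · exact Or.inr ⟨mem_powerset.1 (hA hz), hl⟩
          · exact absurd (key hx hxA hz (hxy.trans hl)) hzy
    · rintro (rfl | ⟨hz, hzy⟩)
      · exact Or.inr hyA
      · by_cases hzx : z = x
        · exact Or.inl hzx
        · exact Or.inr (hlt z hz hzy hzx)
  have hJc : J.card = A.card := by
    have h1 := congrArg card hAJ
    rw [card_insert_of_notMem hxA, card_insert_of_notMem (by simp [hJ, SimpLT.irrefl])] at h1
    omega
  rw [hI.eq_of_card_eq hJi (hc.trans hJc.symm)]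
  exact card_le_card (nhd_subset_of_complementary hx hxy hyA hlt)

/-- **Harper's vertex-isoperimetric theorem** in the hypercube of subsets of `S`. -/
theorem card_nhd_le (S : Finset (Fin n)) : ∀ A I : Finset (Finset (Fin n)), A ⊆ S.powerset →
    IsInit S I → I.card = A.card → (nhd S I).card ≤ (nhd S A).card := by
  induction S using Finset.strongInduction with
  | H S ih =>
    intro A
    induction hM : ∑ x ∈ A, rank S x using Nat.strong_induction_on generalizing A with
    | h M ihM =>
      intro I hA hI hc
      by_cases h : ∀ a ∈ S, IsInit (S.erase a) (A.nonMemberSubfamily a) ∧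
          IsInit (S.erase a) (A.memberSubfamily a)
      · exact card_nhd_le_of_sections_isInit hA h hI hc
      · push Not at h
        obtain ⟨a, ha, h⟩ := h
        have hlt := sum_rank_compress_lt hA ha (by tauto)
        exact (ihM _ (hM ▸ hlt) _ rfl I (compress_subset_powerset ha) hI
          (hc.trans (card_compress hA).symm)).trans
          (card_nhd_compress_le hA ha (ih _ (erase_ssubset ha)))

theorem iterate_nhd (hA : A ⊆ S.powerset) (hI : IsInit S I) (hc : I.card ≤ A.card) (t : ℕ) :
    (nhd S)^[t] A ⊆ S.powerset ∧ IsInit S ((nhd S)^[t] I) ∧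
      ((nhd S)^[t] I).card ≤ ((nhd S)^[t] A).card := by
  induction t with
  | zero => exact ⟨hA, hI, hc⟩
  | succ t ih =>
    obtain ⟨h1, h2, h3⟩ := ih
    rw [Function.iterate_succ_apply', Function.iterate_succ_apply']
    refine ⟨filter_subset _ _, h2.nhd, ?_⟩
    have hJ := isInit_seg S ((nhd S)^[t] A).card
    have hJc := card_seg (card_le_card h1)
    exact (card_le_card (nhd_mono (h2.subset_of_card_le hJ (by rwa [hJc])))).trans
      (card_nhd_le S _ _ h1 hJ hJc)

theorem mem_iterate_nhd_univ (t : ℕ) {w : Finset (Fin n)} :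
    w ∈ (nhd univ)^[t] A ↔ ∃ z ∈ A, (symmDiff z w).card ≤ t := by
  induction t generalizing w with
  | zero => simp [symmDiff_eq_bot, ← bot_eq_empty]
  | succ t ih =>
    rw [Function.iterate_succ_apply', mem_nhd]
    simp only [ih, subset_univ, mem_univ, true_and]
    constructor
    · rintro (⟨z, hz, h⟩ | ⟨i, ⟨z, hz, h⟩ | ⟨z, hz, h⟩⟩)
      · exact ⟨z, hz, by omega⟩
      · refine ⟨z, hz, (card_le_card (t := insert i (symmDiff z (w.erase i))) ?_).trans
          ((card_insert_le _ _).trans (by omega))⟩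
        intro k
        simp only [mem_insert, mem_symmDiff, mem_erase]
        tauto
      · refine ⟨z, hz, (card_le_card (t := insert i (symmDiff z (insert i w))) ?_).trans
          ((card_insert_le _ _).trans (by omega))⟩
        intro k
        simp only [mem_insert, mem_symmDiff]
        tauto
    · rintro ⟨z, hz, h⟩
      rcases (symmDiff z w).eq_empty_or_nonempty with h0 | ⟨i, hi⟩
      · exact Or.inl ⟨z, hz, by simp [h0]⟩
      have hc := card_erase_of_mem hi
      refine Or.inr ⟨i, ?_⟩
      by_cases hiw : i ∈ w
      · refine Or.inl ⟨z, hz, ?_⟩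
        have : symmDiff z (w.erase i) = (symmDiff z w).erase i := by
          ext k; grind [mem_symmDiff]
        rw [this]
        omega
      · refine Or.inr ⟨z, hz, ?_⟩
        have : symmDiff z (insert i w) = (symmDiff z w).erase i := by
          ext k; grind [mem_symmDiff]
        rw [this]
        omega

theorem compl_Cball_eq {p : ℕ} (hp : p < n) (A : Finset (Finset (Fin n))) :
    (Cball n p A)ᶜ = ((nhd univ)^[n - p - 1] A).image compl := by
  ext y
  have hc : ∀ x : Finset (Fin n), (symmDiff x yᶜ).card + (symmDiff x y).card = n := by
    intro x
    have : symmDiff x yᶜ = (symmDiff x y)ᶜ := by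
      ext i; simp only [mem_symmDiff, mem_compl]; tauto
    rw [this, card_compl_add_card, Fintype.card_fin]
  have h1 : y ∈ ((nhd univ)^[n - p - 1] A).image compl ↔ yᶜ ∈ (nhd univ)^[n - p - 1] A := by
    rw [mem_image]
    constructor
    · rintro ⟨z, hz, rfl⟩; rwa [compl_compl]
    · exact fun h => ⟨_, h, compl_compl y⟩
  rw [h1, mem_iterate_nhd_univ, mem_compl, Cball, mem_filter]
  simp only [mem_univ, true_and, not_forall, exists_prop]
  refine exists_congr fun x => and_congr_right fun _ => ?_
  have := hc x
  omega

end Harper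

/-- Among all families of a given size, the initial segment of the simplicial ordering
maximizes `|C^p[A]|`. -/
theorem stmt1 (n p : ℕ) (A : Finset (Finset (Fin n))) :
    (Cball n p A).card ≤ (Cball n p (ISeg n A.card)).card := by
  rcases lt_or_ge p n with hp | hp
  · have hI : ISeg n A.card = Harper.seg univ A.card := by
      simp [ISeg, Harper.seg, Harper.rank]
    have hA : A ⊆ (univ : Finset (Fin n)).powerset := by simp
    have h := (Harper.iterate_nhd hA (Harper.isInit_seg univ A.card)
      (Harper.card_seg (card_le_card hA)).le (n - p - 1)).2.2
    rw [← card_image_of_injective _ compl_injective, ← Harper.compl_Cball_eq hp,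
      ← card_image_of_injective (_^[_] A) compl_injective, ← Harper.compl_Cball_eq hp,
      ← hI] at h
    have h1 := card_add_card_compl (Cball n p A)
    have h2 := card_add_card_compl (Cball n p (ISeg n A.card))
    omega
  · refine card_le_card fun y _ => ?_
    rw [Cball, mem_filter]
    exact ⟨mem_univ _, fun x _ => (card_le_univ _).trans (by simpa using hp)⟩
end

section
/- Let n be odd and (n+1)/2 ≤ p ≤ n−2. Set r = Σ_{i=0}^{p−(n−1)/2} C(n,i) and s = C(p, p−(n−1)/2). Then |C^p(I_{r−s})| = 2^{n−1} − (r − 2s). -/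
open Finset

theorem simpLT_irrefl {n : ℕ} (x : Finset (Fin n)) : ¬ SimpLT x x := by
  rintro (h | ⟨-, i, hi, hi', -⟩)
  · exact lt_irrefl _ h
  · exact hi' hi

theorem simpLT_or_simpLT_of_ne {n : ℕ} {x y : Finset (Fin n)} (h : x ≠ y) :
    SimpLT x y ∨ SimpLT y x := by
  rcases lt_trichotomy x.card y.card with hlt | heq | hgt
  · exact Or.inl (Or.inl hlt)
  · have hne : (symmDiff x y).Nonempty := by
      rw [Finset.nonempty_iff_ne_empty]
      intro h0
      exact h (symmDiff_eq_bot.mp h0)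
    have hmin : ∀ j ∈ symmDiff x y, (symmDiff x y).min' hne ≤ j := fun j hj =>
      Finset.min'_le _ _ hj
    rcases Finset.mem_symmDiff.mp ((symmDiff x y).min'_mem hne) with ⟨h1, h2⟩ | ⟨h1, h2⟩
    · exact Or.inl (Or.inr ⟨heq, _, h1, h2, hmin⟩)
    · exact Or.inr (Or.inr ⟨heq.symm, _, h1, h2, fun j hj => hmin j (symmDiff_comm x y ▸ hj)⟩)
  · exact Or.inr (Or.inl hgt)

/-- A family closed under simplicial predecessors is the initial segment of its cardinality. -/
theorem ISeg_card_eq_of_closed {n : ℕ} {A : Finset (Finset (Fin n))}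
    (hA : ∀ x ∈ A, ∀ z, SimpLT z x → z ∈ A) : ISeg n A.card = A := by
  ext x
  simp only [ISeg, mem_filter, mem_univ, true_and]
  constructor
  · intro hlt
    by_contra hx
    refine absurd hlt (not_lt.mpr (card_le_card fun z hz => ?_))
    rw [mem_filter]
    refine ⟨mem_univ z, ?_⟩
    rcases simpLT_or_simpLT_of_ne (ne_of_mem_of_not_mem hz hx) with h | h
    · exact h
    · exact absurd (hA z hz x h) hx
  · intro hx
    refine card_lt_card ((ssubset_iff_of_subset fun z hz => ?_).mpr ⟨x, hx, ?_⟩)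
    · exact hA x hx z (mem_filter.mp hz).2
    · simp [simpLT_irrefl]

theorem card_symmDiff_add_two_mul_card_inter {α : Type*} [DecidableEq α] (x y : Finset α) :
    (symmDiff x y).card + 2 * (x ∩ y).card = x.card + y.card := by
  have hdisj : Disjoint (x \ y) (y \ x) := disjoint_sdiff_sdiff
  have hcard : (symmDiff x y).card = (x \ y).card + (y \ x).card := by
    rw [← card_union_of_disjoint hdisj]; rfl
  have hx := card_sdiff_add_card_inter x y
  have hy := card_sdiff_add_card_inter y x
  rw [inter_comm] at hy
  omega

theorem card_filter_card_lt (n k : ℕ) :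
    ((univ : Finset (Finset (Fin n))).filter fun x => x.card < k).card =
      ∑ i ∈ range k, n.choose i := by
  rw [card_eq_sum_card_fiberwise (f := Finset.card) (t := range k)
    (fun x hx => by simpa using hx)]
  refine sum_congr rfl fun i hi => ?_
  have : (univ.filter fun x : Finset (Fin n) => x.card < k).filter (fun x => x.card = i) =
      powersetCard i univ := by
    ext x
    simp only [mem_filter, mem_univ, true_and, mem_powersetCard_univ]
    have := mem_range.mp hi
    omega
  rw [this, card_powersetCard, card_univ, Fintype.card_fin]

theorem card_filter_le_val (n c : ℕ) :
    ((univ : Finset (Fin n)).filter fun i => c ≤ i.val).card = n - c := by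
  have hlt := Fin.card_filter_val_lt (n := n) (m := c)
  have hsum := card_filter_add_card_filter_not (s := (univ : Finset (Fin n))) fun i => i.val < c
  simp only [not_lt, card_univ, Fintype.card_fin] at hsum
  omega

/-- The sets of size less than `t`, with the `t`-sets meeting the first `c` elements. -/
def lowMeeting (n t c : ℕ) : Finset (Finset (Fin n)) :=
  univ.filter fun x => x.card < t ∨ x.card = t ∧ ∃ i ∈ x, i.val < c

theorem card_lowMeeting (n t c : ℕ) :
    (lowMeeting n t c).card + (n - c).choose t = ∑ i ∈ range (t + 1), n.choose i := by
  have hdisj : Disjoint (lowMeeting n t c)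
      (powersetCard t (univ.filter fun i : Fin n => c ≤ i.val)) := by
    rw [disjoint_left]
    intro x hx hx'
    simp only [lowMeeting, mem_filter, mem_univ, true_and] at hx
    obtain ⟨hsub, hcard⟩ := mem_powersetCard.mp hx'
    rcases hx with h | ⟨-, i, hi, hic⟩
    · omega
    · have := (mem_filter.mp (hsub hi)).2
      omega
  rw [← card_filter_card_lt, ← card_filter_le_val, ← card_powersetCard,
    ← card_union_of_disjoint hdisj]
  congr 1
  ext x
  simp only [lowMeeting, mem_union, mem_filter, mem_univ, true_and, mem_powersetCard,
    subset_iff]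
  constructor
  · rintro ((h | h) | h) <;> omega
  · intro h
    by_cases hex : ∃ i ∈ x, i.val < c
    · rcases Nat.lt_succ_iff_lt_or_eq.mp h with h | h
      · exact Or.inl (Or.inl h)
      · exact Or.inl (Or.inr ⟨h, hex⟩)
    · push Not at hex
      rcases Nat.lt_succ_iff_lt_or_eq.mp h with h | h
      · exact Or.inl (Or.inl h)
      · exact Or.inr ⟨fun i hi => hex i hi, h⟩

theorem ISeg_eq_lowMeeting (n t c : ℕ) :
    ISeg n ((∑ i ∈ range (t + 1), n.choose i) - (n - c).choose t) = lowMeeting n t c := by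
  rw [← card_lowMeeting n t c, Nat.add_sub_cancel]
  refine ISeg_card_eq_of_closed fun x hx z hz => ?_
  simp only [lowMeeting, mem_filter, mem_univ, true_and] at hx ⊢
  rcases hz with hz | ⟨hz, i, hiz, hix, hmin⟩
  · left; omega
  · rcases hx with h | ⟨h, j, hj, hjc⟩
    · left; omega
    · refine Or.inr ⟨by omega, ?_⟩
      by_cases hjz : j ∈ z
      · exact ⟨j, hjz, hjc⟩
      · have : i ≤ j := hmin j (mem_symmDiff.mpr (Or.inr ⟨hj, hjz⟩))
        exact ⟨i, hiz, lt_of_le_of_lt this hjc⟩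

theorem mem_Cball_lowMeeting {m t : ℕ} (ht : 1 ≤ t) (htm : t ≤ m)
    (y : Finset (Fin (2 * m + 1))) {c : ℕ} :
    y ∈ Cball (2 * m + 1) (m + t) (lowMeeting (2 * m + 1) t c) ↔
      y.card ≤ m ∨ y.card = m + 1 ∧ ∀ i : Fin (2 * m + 1), i.val < c → i ∈ y := by
  have hcompl : yᶜ.card + y.card = 2 * m + 1 := by
    rw [card_compl_add_card, Fintype.card_fin]
  have hout : ∀ x ⊆ yᶜ, (symmDiff x y).card = x.card + y.card := fun x hx => by
    have h := card_symmDiff_add_two_mul_card_inter x y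
    rwa [disjoint_iff_inter_eq_empty.mp (subset_compl_iff_disjoint_right.mp hx), card_empty,
      mul_zero, add_zero] at h
  simp only [Cball, mem_filter, mem_univ, true_and, lowMeeting]
  constructor
  · intro hball
    by_contra! hy
    obtain ⟨hm, hy⟩ := hy
    by_cases hcard : y.card = m + 1
    · obtain ⟨i, hic, hiy⟩ := hy hcard
      obtain ⟨x, hix, hxy, hx⟩ := exists_subsuperset_card_eq
        (singleton_subset_iff.mpr (mem_compl.mpr hiy)) (by simpa using ht)
        (show t ≤ yᶜ.card by omega)
      have := hball x (Or.inr ⟨hx, i, singleton_subset_iff.mp hix, hic⟩)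
      rw [hout x hxy] at this
      omega
    · obtain ⟨x, hxy, hx⟩ := exists_subset_card_eq (Nat.min_le_right (t - 1) yᶜ.card)
      have := hball x (Or.inl (by omega))
      rw [hout x hxy] at this
      omega
  · intro hy x hx
    have hsum := card_symmDiff_add_two_mul_card_inter x y
    rcases hy with hy | ⟨hy, hsub⟩
    · omega
    · rcases hx with hx | ⟨hx, i, hi, hic⟩
      · omega
      · have : 0 < (x ∩ y).card := card_pos.mpr ⟨i, mem_inter.mpr ⟨hi, hsub i hic⟩⟩
        omega

theorem card_filter_card_eq_forall_mem (m c : ℕ) :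
    ((univ : Finset (Finset (Fin (2 * m + 1)))).filter fun y =>
      y.card = m + 1 ∧ ∀ i : Fin (2 * m + 1), i.val < c → i ∈ y).card =
      (2 * m + 1 - c).choose m := by
  rw [← card_filter_le_val, ← card_powersetCard]
  refine card_bij' (fun y _ => yᶜ) (fun y _ => yᶜ) ?_ ?_ (by simp) (by simp)
  · intro y hy
    simp only [mem_filter, mem_univ, true_and] at hy
    have := card_compl_add_card y
    rw [Fintype.card_fin] at this
    refine mem_powersetCard.mpr ⟨fun i hi => ?_, by omega⟩
    simp only [mem_filter, mem_univ, true_and]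
    by_contra! hic
    exact mem_compl.mp hi (hy.2 i hic)
  · intro y hy
    obtain ⟨hsub, hcard⟩ := mem_powersetCard.mp hy
    have := card_compl_add_card y
    rw [Fintype.card_fin] at this
    simp only [mem_filter, mem_univ, true_and]
    refine ⟨by omega, fun i hic => mem_compl.mpr fun hi => ?_⟩
    have := (mem_filter.mp (hsub hi)).2
    omega

theorem card_Cball_lowMeeting {m t : ℕ} (ht : 1 ≤ t) (htm : t ≤ m) (c : ℕ) :
    (Cball (2 * m + 1) (m + t) (lowMeeting (2 * m + 1) t c)).card =
      4 ^ m + (2 * m + 1 - c).choose m := by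
  rw [← Nat.sum_range_choose_halfway, ← card_filter_card_lt, ← card_filter_card_eq_forall_mem,
    ← card_union_of_disjoint]
  · congr 1
    ext y
    rw [mem_Cball_lowMeeting ht htm]
    simp only [mem_union, mem_filter, mem_univ, true_and, Nat.lt_succ_iff]
  · rw [disjoint_left]
    intro y hy hy'
    simp only [mem_filter, mem_univ, true_and] at hy hy'
    omega


/-- For odd `n` and `(n+1)/2 ≤ p ≤ n-2`, with `r = ∑_{i=0}^{p-(n-1)/2} C(n,i)` and
`s = C(p, p-(n-1)/2)`, we have `|C^p(I_{r-s})| = 2^{n-1} - (r - 2s)`. -/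
theorem stmt3 (n p : ℕ) (hodd : Odd n) (hp1 : (n + 1) / 2 ≤ p) (hp2 : p ≤ n - 2)
    (r s : ℕ)
    (hr : r = ∑ i ∈ Finset.range (p - (n - 1) / 2 + 1), Nat.choose n i)
    (hs : s = Nat.choose p (p - (n - 1) / 2)) :
    ((Cpunct n p (ISeg n (r - s))).card : ℤ) = 2 ^ (n - 1) - ((r : ℤ) - 2 * (s : ℤ)) := by
  obtain ⟨m, rfl⟩ := hodd
  obtain ⟨t, rfl⟩ : ∃ t, p = m + t := ⟨p - m, by omega⟩
  have ht : 1 ≤ t := by omega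
  have htm : t ≤ m := by omega
  have hmt : m + t - (2 * m + 1 - 1) / 2 = t := by omega
  have hc : 2 * m + 1 - (m + 1 - t) = m + t := by omega
  rw [hmt] at hr hs
  have hA := card_lowMeeting (2 * m + 1) t (m + 1 - t)
  have hI := ISeg_eq_lowMeeting (2 * m + 1) t (m + 1 - t)
  have hB := card_Cball_lowMeeting ht htm (m + 1 - t)
  rw [hc, ← hs, ← hr] at hA hI
  rw [hc, Nat.choose_symm_add, ← hs] at hB
  have hsub : lowMeeting (2 * m + 1) t (m + 1 - t) ⊆
      Cball (2 * m + 1) (m + t) (lowMeeting (2 * m + 1) t (m + 1 - t)) := fun x hx => by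
    rw [mem_Cball_lowMeeting ht htm]
    simp only [lowMeeting, mem_filter, mem_univ, true_and] at hx
    omega
  have hP := card_sdiff_add_card_eq_card hsub
  rw [hI, Cpunct, show (2 : ℤ) ^ (2 * m + 1 - 1) = 4 ^ m by
    rw [Nat.add_sub_cancel, pow_mul]; norm_num]
  zify at hP hA hB
  linarith
end

section
/- Let n be odd and (n+1)/2 ≤ p ≤ n−2. Set r = Σ_{i=0}^{p−(n−1)/2} C(n,i) and s = C(p, p−(n−1)/2). Then |C^p(I_{r−s+1})| < 2^{n−1} − (r − 2s + 1). -/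
open Finset

/-- The number of subsets of `[n]` of size at most `k`. -/
theorem card_filter_card_le (n k : ℕ) :
    (univ.filter fun x : Finset (Fin n) => x.card ≤ k).card
      = ∑ i ∈ range (k + 1), n.choose i := by
  rw [card_eq_sum_card_fiberwise (f := Finset.card) (t := range (k + 1))
    (fun x hx => by simp at hx ⊢; omega)]
  refine sum_congr rfl fun i hi => ?_
  have : ((univ.filter fun x : Finset (Fin n) => x.card ≤ k).filter fun x => x.card = i)
      = powersetCard i univ := by
    ext x
    simp only [mem_filter, mem_univ, true_and, mem_powersetCard, subset_univ]
    rw [mem_range] at hi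
    omega
  rw [this, card_powersetCard, card_univ, Fintype.card_fin]

theorem card_symmDiff_of_subset_compl {n : ℕ} {x y : Finset (Fin n)} (h : x ⊆ yᶜ) :
    (symmDiff x y).card = x.card + y.card := by
  have hd : Disjoint x y := by rwa [← le_compl_iff_disjoint_right]
  rw [hd.symmDiff_eq_sup, sup_eq_union, card_union_of_disjoint hd]

theorem card_symmDiff_le {n : ℕ} (x y : Finset (Fin n)) :
    (symmDiff x y).card ≤ x.card + y.card :=
  (card_le_card symmDiff_le_sup).trans (card_union_le x y)

/-- The last elements of `[n]`, from position `a` on. -/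
def finTail (n a : ℕ) : Finset (Fin n) :=
  univ.filter fun i => a ≤ i.val

/-- The `k` consecutive elements of `[n]` starting at position `a`. -/
def finBlock (n a k : ℕ) : Finset (Fin n) :=
  univ.filter fun i => a ≤ i.val ∧ i.val < a + k

theorem card_finBlock {n a k : ℕ} (h : a + k ≤ n) : (finBlock n a k).card = k := by
  have : (finBlock n a k).map Fin.valEmbedding = Ico a (a + k) := by
    ext i
    simp only [finBlock, mem_map, mem_filter, mem_univ, true_and, Fin.valEmbedding_apply, mem_Ico]
    constructor
    · rintro ⟨j, hj, rfl⟩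
      exact hj
    · intro hi
      exact ⟨⟨i, by omega⟩, hi, rfl⟩
  rw [← card_map, this, Nat.card_Ico]
  omega

theorem card_finTail {n a : ℕ} (h : a ≤ n) : (finTail n a).card = n - a := by
  rw [← card_finBlock (n := n) (a := a) (k := n - a) (by omega)]
  congr 1
  ext i
  simp only [finTail, finBlock, mem_filter, mem_univ, true_and]
  omega

theorem finBlock_subset_finTail (n a k : ℕ) : finBlock n a k ⊆ finTail n a := by
  intro i
  simp only [finTail, finBlock, mem_filter, mem_univ, true_and]
  exact And.left

/-- The sets of size at most `k`, except for the `k`-sets contained in the tail from `a`. -/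
def lowSets (n a k : ℕ) : Finset (Finset (Fin n)) :=
  (univ.filter fun x => x.card ≤ k) \ powersetCard k (finTail n a)

theorem mem_lowSets {n a k : ℕ} {x : Finset (Fin n)} :
    x ∈ lowSets n a k ↔ x.card ≤ k ∧ ¬ (x ⊆ finTail n a ∧ x.card = k) := by
  simp [lowSets, mem_powersetCard]

theorem card_lowSets {n a k : ℕ} (h : a ≤ n) :
    (lowSets n a k).card = ∑ i ∈ range (k + 1), n.choose i - (n - a).choose k := by
  have hsub : powersetCard k (finTail n a) ⊆ univ.filter fun x => x.card ≤ k := by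
    intro x hx
    simpa using (mem_powersetCard.1 hx).2.le
  rw [lowSets, card_sdiff_of_subset hsub, card_filter_card_le, card_powersetCard, card_finTail h]

theorem mem_lowSets_of_simpLT {n a k : ℕ} {x z : Finset (Fin n)}
    (hx : x ∈ lowSets n a k) (hz : SimpLT z x) : z ∈ lowSets n a k := by
  rw [mem_lowSets] at *
  rcases hz with hlt | ⟨heq, i, hiz, hix, hmin⟩
  · exact ⟨by omega, fun h => by omega⟩
  · refine ⟨by omega, fun ⟨hsub, hzk⟩ => hx.2 ⟨fun j hj => ?_, by omega⟩⟩
    by_contra hjt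
    have hij : i ≤ j := hmin j (mem_symmDiff.2 (Or.inr ⟨hj, fun h => hjt (hsub h)⟩))
    have hi := hsub hiz
    simp only [finTail, mem_filter, mem_univ, true_and] at hi hjt
    exact hjt (hi.trans hij)

theorem mem_lowSets_of_simpLT_finBlock {n a k : ℕ} (h : a + k ≤ n) {z : Finset (Fin n)}
    (hz : SimpLT z (finBlock n a k)) : z ∈ lowSets n a k := by
  have hc := card_finBlock h
  rw [mem_lowSets]
  rcases hz with hlt | ⟨heq, i, hiz, hix, hmin⟩
  · exact ⟨by omega, fun h => by omega⟩
  · refine ⟨by omega, fun ⟨hsub, hzk⟩ => hix ?_⟩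
    have hi := hsub hiz
    have hbz : finBlock n a k ⊆ z := by
      intro j hj
      by_contra hjz
      have hij : i.val ≤ j.val := hmin j (mem_symmDiff.2 (Or.inr ⟨hj, hjz⟩))
      apply hix
      simp only [finTail, finBlock, mem_filter, mem_univ, true_and] at hi hj ⊢
      omega
    rwa [eq_of_subset_of_card_le hbz heq.le]

theorem insert_finBlock_lowSets_subset_ISeg {n a k : ℕ} (h : a + k ≤ n) :
    insert (finBlock n a k) (lowSets n a k) ⊆ ISeg n ((lowSets n a k).card + 1) := by
  intro x hx
  rw [ISeg, mem_filter]
  refine ⟨mem_univ x, Nat.lt_succ_of_le (card_le_card fun z hz => ?_)⟩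
  have hzx := (mem_filter.1 hz).2
  rcases mem_insert.1 hx with rfl | hx
  · exact mem_lowSets_of_simpLT_finBlock h hzx
  · exact mem_lowSets_of_simpLT hx hzx

/-- A set within distance `m + k` of all members of `A` has size at most `m`, or it has size `m + 1`
and its complement lies in the tail and does not contain the block. -/
theorem card_le_or_of_mem_Cball {m k : ℕ} (hk : 1 ≤ k) (hkm : k < m)
    {A : Finset (Finset (Fin (2 * m + 1)))}
    (hA : insert (finBlock (2 * m + 1) (m + 1 - k) k) (lowSets (2 * m + 1) (m + 1 - k) k) ⊆ A)
    {y : Finset (Fin (2 * m + 1))} (hy : y ∈ Cball (2 * m + 1) (m + k) A) :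
    y.card ≤ m ∨ (yᶜ ∈ powersetCard m (finTail (2 * m + 1) (m + 1 - k)) ∧
      ¬ finBlock (2 * m + 1) (m + 1 - k) k ⊆ yᶜ) := by
  have hdist : ∀ x ∈ insert (finBlock (2 * m + 1) (m + 1 - k) k)
      (lowSets (2 * m + 1) (m + 1 - k) k), x ⊆ yᶜ → x.card + y.card ≤ m + k := by
    intro x hx hxy
    rw [← card_symmDiff_of_subset_compl hxy]
    exact (mem_filter.1 hy).2 x (hA hx)
  have hyc : yᶜ.card = 2 * m + 1 - y.card := by rw [card_compl, Fintype.card_fin]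
  have hyn : y.card ≤ 2 * m + 1 := by simpa using card_le_univ y
  have hy1 : y.card ≤ m + 1 := by
    obtain ⟨x, hxy, hx⟩ := exists_subset_card_eq (min_le_right (k - 1) yᶜ.card)
    have := hdist x (mem_insert_of_mem (mem_lowSets.2 ⟨by omega, fun h => by omega⟩)) hxy
    omega
  refine or_iff_not_imp_left.2 fun hym => ⟨mem_powersetCard.2 ⟨fun j hj => ?_, by omega⟩,
    fun hb => ?_⟩
  · by_contra hjt
    obtain ⟨x, hjx, hxy, hx⟩ := exists_subsuperset_card_eq (singleton_subset_iff.2 hj)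
      (n := k) (by simpa using hk) (by omega)
    have := hdist x (mem_insert_of_mem (mem_lowSets.2 ⟨hx.le,
      fun h => hjt (h.1 (singleton_subset_iff.1 hjx))⟩)) hxy
    omega
  · have := hdist _ (mem_insert_self _ _) hb
    rw [card_finBlock (by omega)] at this
    omega

theorem card_Cball_sdiff_lt {m k : ℕ} (hk : 1 ≤ k) (hkm : k < m)
    {A : Finset (Finset (Fin (2 * m + 1)))}
    (hA : insert (finBlock (2 * m + 1) (m + 1 - k) k) (lowSets (2 * m + 1) (m + 1 - k) k) ⊆ A) :
    (Cball (2 * m + 1) (m + k) A \ A).card + (lowSets (2 * m + 1) (m + 1 - k) k).card + 1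
      < 4 ^ m + (m + k).choose k := by
  set L := finTail (2 * m + 1) (m + 1 - k) with hL
  set b := finBlock (2 * m + 1) (m + 1 - k) k with hb
  set F := lowSets (2 * m + 1) (m + 1 - k) k with hF
  have hbL : b ⊆ L := finBlock_subset_finTail _ _ _
  have hbc : b.card = k := card_finBlock (by omega)
  have hLc : L.card = m + k := by rw [hL, card_finTail (by omega)]; omega
  obtain ⟨T, hbT, hTL, hT⟩ := exists_subsuperset_card_eq hbL (n := m) (by omega) (by omega)
  set S := univ.filter fun x : Finset (Fin (2 * m + 1)) => x.card ≤ m with hS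
  set U := ((powersetCard m L).erase T).image compl with hU
  have hbF : b ∉ F := fun h => (mem_lowSets.1 h).2 ⟨hbL, hbc⟩
  have hsubS : insert b F ⊆ S ∪ U := by
    intro x hx
    refine mem_union_left _ (mem_filter.2 ⟨mem_univ x, ?_⟩)
    rcases mem_insert.1 hx with rfl | hx
    · omega
    · exact (mem_lowSets.1 hx).1.trans hkm.le
  have hsub : Cball (2 * m + 1) (m + k) A \ A ⊆ (S ∪ U) \ insert b F := by
    intro y hy
    rw [mem_sdiff] at hy ⊢
    refine ⟨?_, fun h => hy.2 (hA h)⟩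
    rcases card_le_or_of_mem_Cball hk hkm hA hy.1 with h | ⟨h, hn⟩
    · exact mem_union_left _ (mem_filter.2 ⟨mem_univ y, h⟩)
    · refine mem_union_right _ (mem_image.2 ⟨yᶜ, mem_erase.2 ⟨?_, h⟩, compl_compl y⟩)
      rintro rfl
      exact hn hbT
  have hSc : S.card = 4 ^ m := by rw [hS, card_filter_card_le, Nat.sum_range_choose_halfway]
  have hUc : U.card < (m + k).choose k := by
    calc U.card ≤ ((powersetCard m L).erase T).card := card_image_le
      _ < (powersetCard m L).card := card_erase_lt_of_mem (mem_powersetCard.2 ⟨hTL, hT⟩)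
      _ = (m + k).choose k := by rw [card_powersetCard, hLc, Nat.choose_symm_add]
  have h1 := card_le_card hsub
  have h2 := card_le_card hsubS
  rw [card_sdiff_of_subset hsubS] at h1
  rw [card_insert_of_notMem hbF] at h1 h2
  have h3 := card_union_le S U
  omega

/-- For odd `n` and `(n+1)/2 ≤ p ≤ n-2`, with `r = ∑_{i=0}^{p-(n-1)/2} C(n,i)` and
`s = C(p, p-(n-1)/2)`, we have `|C^p(I_{r-s+1})| < 2^{n-1} - (r - 2s + 1)`. -/
theorem stmt5 (n p : ℕ) (hodd : Odd n) (hp1 : (n + 1) / 2 ≤ p) (hp2 : p ≤ n - 2)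
    (r s : ℕ)
    (hr : r = ∑ i ∈ Finset.range (p - (n - 1) / 2 + 1), Nat.choose n i)
    (hs : s = Nat.choose p (p - (n - 1) / 2)) :
    ((Cpunct n p (ISeg n (r - s + 1))).card : ℤ)
      < 2 ^ (n - 1) - ((r : ℤ) - 2 * (s : ℤ) + 1) := by
  obtain ⟨m, rfl⟩ := hodd
  obtain ⟨k, rfl⟩ : ∃ k, p = m + k := ⟨p - m, by omega⟩
  have hm : (2 * m + 1 - 1) / 2 = m := by omega
  rw [hm, Nat.add_sub_cancel_left] at hr hs
  have hk : 1 ≤ k := by omega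
  have hkm : k < m := by omega
  have hF : (lowSets (2 * m + 1) (m + 1 - k) k).card = r - s := by
    rw [card_lowSets (by omega), hr, hs]
    congr 2
    omega
  have hsr : s ≤ r := by
    rw [hr, hs]
    calc (m + k).choose k ≤ (2 * m + 1).choose k := Nat.choose_le_choose k (by omega)
      _ ≤ _ := single_le_sum (f := fun i => (2 * m + 1).choose i) (fun _ _ => Nat.zero_le _)
        (self_mem_range_succ k)
  have hA := insert_finBlock_lowSets_subset_ISeg (n := 2 * m + 1) (a := m + 1 - k) (k := k)
    (by omega)
  rw [hF] at hA
  have hlt := card_Cball_sdiff_lt hk hkm hA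
  rw [hF, ← hs] at hlt
  have hpow : (2 : ℤ) ^ (2 * m + 1 - 1) = (4 ^ m : ℕ) := by
    rw [Nat.add_sub_cancel, pow_mul]
    norm_num
  rw [hpow, Cpunct]
  omega
end

section
/- Let n, p, ℓ ∈ ℕ with ℓ ≤ 2^{n−1}. If the graph Q_n^p admits a b-coloring with 2^{n−1} + ℓ colors, then there exists a set A of subsets of [n] with |A| = 2ℓ which is a clique in Q_n^p (i.e., any two distinct members of A have symmetric difference of size between 1 and p) such that |C^p(A)| ≥ 2^{n−1} − ℓ. -/
open Finset

/-- A b-coloring with `k` colors of a finite graph has at least `2k - |V|` singleton color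
classes, and the vertex of a singleton class is adjacent to the chosen dominating vertex of every
other class. -/
theorem HasBColoring.exists_dominating_family {V : Type*} [Fintype V] {G : SimpleGraph V}
    {k m : ℕ} (h : HasBColoring G k) (hm : Fintype.card V + m ≤ 2 * k) :
    ∃ (v : Fin k → V) (B : Finset (Fin k)), Function.Injective v ∧ B.card = m ∧
      ∀ j ∈ B, ∀ i, i ≠ j → G.Adj (v i) (v j) := by
  classical
  obtain ⟨c, -, hb⟩ := h
  choose v hv hdom using hb
  let T : Finset (Fin k) := univ.filter fun i => ∀ w, c w = i → w = v i
  have hfiber : ∀ i, 2 ≤ (univ.filter fun w => c w = i).card + if i ∈ T then 1 else 0 := by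
    intro i
    have hi : v i ∈ univ.filter fun w => c w = i := by simp [hv]
    split_ifs with hT
    · have := card_pos.mpr ⟨_, hi⟩
      omega
    · obtain ⟨w, hw, hne⟩ : ∃ w, c w = i ∧ w ≠ v i := by simpa [T] using hT
      have : 1 < (univ.filter fun w => c w = i).card :=
        one_lt_card.mpr ⟨w, by simpa using hw, v i, hi, hne⟩
      omega
  have hsum := sum_le_sum fun i (_ : i ∈ univ) => hfiber i
  rw [sum_add_distrib, ← card_eq_sum_card_fiberwise (fun _ _ => mem_coe.mpr (mem_univ _)),
    sum_boole] at hsum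
  simp only [sum_const, card_univ, Fintype.card_fin, smul_eq_mul, filter_univ_mem,
    Nat.cast_id] at hsum
  obtain ⟨B, hBT, hB⟩ := exists_subset_card_eq (show m ≤ T.card by omega)
  refine ⟨v, B, fun i j hij => by rw [← hv i, hij, hv], hB, fun j hj i hij => ?_⟩
  obtain ⟨w, hw, hwj⟩ := hdom i j hij.symm
  rwa [← (mem_filter.mp (hBT hj)).2 w hwj]

/-- If `Q_n^p` admits a b-coloring with `2^{n-1} + ℓ` colors (`ℓ ≤ 2^{n-1}`), then there
is a clique `A` of size `2ℓ` in `Q_n^p` with `|C^p(A)| ≥ 2^{n-1} - ℓ`. -/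
theorem stmt7 (n p ℓ : ℕ) (hℓ : ℓ ≤ 2 ^ (n - 1))
    (h : HasBColoring (cubePow n p) (2 ^ (n - 1) + ℓ)) :
    ∃ A : Finset (Finset (Fin n)), A.card = 2 * ℓ ∧
      (∀ x ∈ A, ∀ y ∈ A, x ≠ y →
        1 ≤ (symmDiff x y).card ∧ (symmDiff x y).card ≤ p) ∧
      2 ^ (n - 1) - ℓ ≤ (Cpunct n p A).card := by
  have hcard : Fintype.card (Finset (Fin n)) + 2 * ℓ ≤ 2 * (2 ^ (n - 1) + ℓ) := by
    rcases n with _ | n <;> simp [pow_succ] <;> omega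
  obtain ⟨v, B, hinj, hB, hadj⟩ := h.exists_dominating_family hcard
  refine ⟨B.image v, by rw [card_image_of_injective _ hinj, hB], ?_, ?_⟩
  · intro x hx y hy hxy
    obtain ⟨i, -, rfl⟩ := mem_image.mp hx
    obtain ⟨j, hj, rfl⟩ := mem_image.mp hy
    exact hadj j hj i (ne_of_apply_ne v hxy)
  · have hsub : Bᶜ.image v ⊆ Cpunct n p (B.image v) := by
      intro y hy
      obtain ⟨i, hi, rfl⟩ := mem_image.mp hy
      rw [mem_compl] at hi
      refine mem_sdiff.mpr ⟨mem_filter.mpr ⟨mem_univ _, fun x hx => ?_⟩, ?_⟩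
      · obtain ⟨j, hj, rfl⟩ := mem_image.mp hx
        exact (hadj j hj i (ne_of_mem_of_not_mem hj hi).symm).symm.2
      · rwa [hinj.mem_finset_image]
    have := card_le_card hsub
    rw [card_image_of_injective _ hinj, card_compl, Fintype.card_fin, hB] at this
    omega
end

section
/- For any odd n ≥ 5 and (n+1)/2 ≤ p ≤ n−2, with r = Σ_{i=0}^{p−(n−1)/2} C(n,i), the b-chromatic number of Q_n^p satisfies b(Q_n^p) ≤ 2^{n−1} + ⌈r/2⌉ − 1; equivalently, Q_n^p admits no b-coloring with more than 2^{n−1} + ⌈r/2⌉ − 1 colors. -/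
open Finset

/-! ### The vertex-isoperimetric inequality in the hypercube

`isoBound n` is the concave piecewise linear function that sends the size of each Hamming ball of
`Q_n` to the size of the ball whose radius is larger by one. A nonempty set of `s` vertices has at
least `isoBound n s` vertices in its closed neighborhood. -/

/-- The number of subsets of an `n`-set of size less than `j`, as a real number. -/
noncomputable def ballCard (n j : ℕ) : ℝ := ∑ i ∈ range j, (n.choose i : ℝ)

/-- The linear function extending the piece of `isoBound n` on `[ballCard n i, ballCard n (i + 1)]`,
whose slope is `C(n, i + 1) / C(n, i)`. -/
noncomputable def isoLine (n i : ℕ) (s : ℝ) : ℝ :=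
  ballCard n (i + 1) + (s - ballCard n i) * ((n + 1) / (i + 1) - 1)

/-- The lower bound for the closed neighborhood of a set of size `s` in the `n`-cube. -/
noncomputable def isoBound (n : ℕ) (s : ℝ) : ℝ :=
  (range (n + 1)).inf' nonempty_range_add_one fun i => isoLine n i s

lemma ballCard_zero (n : ℕ) : ballCard n 0 = 0 := by simp [ballCard]

lemma ballCard_succ (n j : ℕ) : ballCard n (j + 1) = ballCard n j + n.choose j := by
  simp [ballCard, sum_range_succ]

lemma ballCard_self (n : ℕ) : ballCard n (n + 1) = 2 ^ n := by
  unfold ballCard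
  exact_mod_cast Nat.sum_range_choose n

lemma ballCard_succ_succ (n j : ℕ) :
    ballCard (n + 1) (j + 1) = ballCard n (j + 1) + ballCard n j := by
  induction j with
  | zero => simp [ballCard]
  | succ j ih =>
    rw [ballCard_succ (n + 1), ih, Nat.choose_succ_succ, ballCard_succ n (j + 1),
      ballCard_succ n j]
    push_cast
    ring

lemma cast_choose_succ (n j : ℕ) :
    (n.choose (j + 1) : ℝ) = n.choose j * ((n + 1) / (j + 1) - 1) := by
  have hj : (j : ℝ) + 1 ≠ 0 := by positivity
  have h := Nat.add_one_mul_choose_eq n j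
  rw [Nat.choose_succ_succ] at h
  have h' : ((n : ℝ) + 1) * n.choose j = (n.choose j + n.choose (j + 1)) * (j + 1) := by
    exact_mod_cast h
  field_simp
  linarith

lemma isoSlope_anti (n : ℕ) {i j : ℕ} (h : i ≤ j) :
    ((n : ℝ) + 1) / (j + 1) - 1 ≤ (n + 1) / (i + 1) - 1 := by
  gcongr

lemma ballCard_succ_le_isoLine (n i j : ℕ) :
    ballCard n (j + 1) ≤ isoLine n i (ballCard n j) := by
  rcases le_total i j with h | h
  · induction j, h using Nat.le_induction with
    | base => simp [isoLine]
    | succ j h ih =>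
      have := mul_le_mul_of_nonneg_left (isoSlope_anti n h) (Nat.cast_nonneg (α := ℝ) (n.choose j))
      rw [← cast_choose_succ] at this
      unfold isoLine at ih ⊢
      rw [ballCard_succ n (j + 1), ballCard_succ n j] at *
      linarith
  · induction h using Nat.decreasingInduction with
    | self => simp [isoLine]
    | of_succ j h ih =>
      have := mul_le_mul_of_nonneg_left (isoSlope_anti n h.le)
        (Nat.cast_nonneg (α := ℝ) (n.choose j))
      rw [← cast_choose_succ] at this
      unfold isoLine at ih ⊢
      rw [ballCard_succ n (j + 1), ballCard_succ n j] at *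
      linarith

lemma isoBound_mono (n : ℕ) : Monotone (isoBound n) := by
  intro s t hst
  refine le_inf' _ _ fun i hi => (inf'_le _ hi).trans ?_
  have hi' : (i : ℝ) + 1 ≤ n + 1 := by exact_mod_cast mem_range.1 hi
  have : (0 : ℝ) ≤ (n + 1) / (i + 1) - 1 := by
    rw [sub_nonneg, le_div_iff₀ (by positivity)]
    linarith
  unfold isoLine
  gcongr

lemma isoBound_concave (n : ℕ) : ConcaveOn ℝ Set.univ (isoBound n) := by
  refine ⟨convex_univ, fun s _ t _ a b ha hb hab => le_inf' _ _ fun i hi => ?_⟩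
  have hs : isoBound n s ≤ isoLine n i s := inf'_le _ hi
  have ht : isoBound n t ≤ isoLine n i t := inf'_le _ hi
  have : isoLine n i (a • s + b • t) = a * isoLine n i s + b * isoLine n i t := by
    obtain rfl : b = 1 - a := by linarith
    simp only [isoLine, smul_eq_mul]
    ring
  rw [this, smul_eq_mul, smul_eq_mul]
  gcongr

/-- `isoBound` increases when two arguments with a fixed sum move together. -/
lemma isoBound_add_le (n : ℕ) {a₀ a₁ b₀ b₁ : ℝ} (h₁ : b₁ ≤ a₁) (h₀ : b₁ ≤ a₀)
    (hsum : a₀ + a₁ = b₀ + b₁) :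
    isoBound n b₀ + isoBound n b₁ ≤ isoBound n a₀ + isoBound n a₁ := by
  rcases eq_or_lt_of_le (show b₁ ≤ b₀ by linarith) with h | h
  · obtain rfl : a₀ = b₀ := by linarith
    obtain rfl : a₁ = b₁ := by linarith
    rfl
  have hd : 0 < b₀ - b₁ := by linarith
  set c := (a₀ - b₁) / (b₀ - b₁) with hc
  have hc0 : 0 ≤ c := div_nonneg (by linarith) hd.le
  have hc1 : c ≤ 1 := by rw [hc, div_le_one hd]; linarith
  have hcd : c * (b₀ - b₁) = a₀ - b₁ := div_mul_cancel₀ _ hd.ne'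
  have e₀ := (isoBound_concave n).2 (Set.mem_univ b₀) (Set.mem_univ b₁) hc0
    (sub_nonneg.2 hc1) (by ring)
  have e₁ := (isoBound_concave n).2 (Set.mem_univ b₀) (Set.mem_univ b₁)
    (sub_nonneg.2 hc1) hc0 (by ring)
  simp only [smul_eq_mul] at e₀ e₁
  rw [show c * b₀ + (1 - c) * b₁ = a₀ by linarith] at e₀
  rw [show (1 - c) * b₀ + c * b₁ = a₁ by linarith] at e₁
  linarith

lemma ballCard_succ_le_isoBound (n j : ℕ) : ballCard n (j + 1) ≤ isoBound n (ballCard n j) :=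
  le_inf' _ _ fun i _ => ballCard_succ_le_isoLine n i j

lemma le_isoBound_segment (n j : ℕ) {x : ℝ} (hx0 : 0 ≤ x) (hx1 : x ≤ 1) :
    ballCard n (j + 1) + x * n.choose (j + 1) ≤ isoBound n (ballCard n j + x * n.choose j) := by
  have h := (isoBound_concave n).2 (Set.mem_univ (ballCard n j))
    (Set.mem_univ (ballCard n (j + 1))) (sub_nonneg.2 hx1) hx0 (by ring)
  simp only [smul_eq_mul] at h
  rw [show (1 - x) * ballCard n j + x * ballCard n (j + 1) = ballCard n j + x * n.choose j by
    rw [ballCard_succ]; ring] at h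
  have h₀ := mul_le_mul_of_nonneg_left (ballCard_succ_le_isoBound n j) (sub_nonneg.2 hx1)
  have h₁ := mul_le_mul_of_nonneg_left (ballCard_succ_le_isoBound n (j + 1)) hx0
  rw [ballCard_succ n (j + 1)] at h₁
  linarith

lemma isoBound_segment_le {n j : ℕ} (hj : j ≤ n) (x : ℝ) :
    isoBound n (ballCard n j + x * n.choose j) ≤
      ballCard n (j + 1) + x * n.choose (j + 1) := by
  refine (inf'_le _ (mem_range.2 (Nat.lt_succ_of_le hj))).trans (le_of_eq ?_)
  rw [isoLine, cast_choose_succ]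
  ring

lemma exists_segment {n J : ℕ} (hJ : J ≤ n) {s : ℝ} (h1 : 1 ≤ s)
    (hs : s ≤ ballCard (n + 1) (J + 2)) :
    ∃ j ≤ n, ∃ x : ℝ, 0 ≤ x ∧ x ≤ 1 ∧
      s = ballCard (n + 1) (j + 1) + x * (n + 1).choose (j + 1) := by
  induction J with
  | zero =>
    refine ⟨0, hJ, (s - 1) / (n + 1), div_nonneg (by linarith) (by positivity), ?_, ?_⟩
    · rw [div_le_one (by positivity)]
      simp [ballCard, sum_range_succ] at hs
      linarith
    · simp [ballCard]
      field_simp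
      ring
  | succ J ih =>
    rcases le_total s (ballCard (n + 1) (J + 2)) with h | h
    · exact ih (by omega) h
    · have hC : (0 : ℝ) < (n + 1).choose (J + 1 + 1) := by
        exact_mod_cast Nat.choose_pos (by omega)
      refine ⟨J + 1, hJ, (s - ballCard (n + 1) (J + 2)) / (n + 1).choose (J + 1 + 1),
        div_nonneg (by linarith) hC.le, ?_, ?_⟩
      · rw [div_le_one hC]
        rw [ballCard_succ (n + 1) (J + 1 + 1)] at hs
        linarith
      · rw [div_mul_cancel₀ _ hC.ne']
        ring

/-- The numerical inequality behind splitting the cube into two halves. -/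
lemma isoBound_succ_le {n : ℕ} {a₀ a₁ v₀ v₁ : ℝ} (h10 : a₁ ≤ a₀) (h1 : 1 ≤ a₀ + a₁)
    (hle : a₀ + a₁ ≤ 2 ^ (n + 1)) (hv₀ : isoBound n a₀ ≤ v₀) (hv₁ : a₀ ≤ v₁)
    (hv₁' : 0 < a₁ → isoBound n a₁ ≤ v₁) :
    isoBound (n + 1) (a₀ + a₁) ≤ v₀ + v₁ := by
  rw [← ballCard_self] at hle
  obtain ⟨j, hj, x, hx0, hx1, hs⟩ := exists_segment le_rfl h1 hle
  rw [hs]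
  refine (isoBound_segment_le (by omega) x).trans ?_
  set b₀ := ballCard n (j + 1) + x * n.choose (j + 1) with hb₀
  set b₁ := ballCard n j + x * n.choose j with hb₁
  have hb : a₀ + a₁ = b₀ + b₁ := by
    rw [hs, ballCard_succ_succ, Nat.choose_succ_succ, hb₀, hb₁]
    push_cast
    ring
  have hb1 : 0 ≤ b₁ := by
    have : 0 ≤ ballCard n j := sum_nonneg fun _ _ => Nat.cast_nonneg _
    positivity
  have g₁ : b₀ ≤ isoBound n b₁ := le_isoBound_segment n j hx0 hx1
  have g₀ := le_isoBound_segment n (j + 1) hx0 hx1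
  have hsum : ballCard (n + 1) (j + 1 + 1) + x * (n + 1).choose (j + 1 + 1) =
      (ballCard n (j + 1 + 1) + x * n.choose (j + 1 + 1)) + b₀ := by
    rw [ballCard_succ_succ, Nat.choose_succ_succ, hb₀]
    push_cast
    ring
  rw [hsum]
  rcases le_or_gt b₀ a₀ with h | h
  · have := isoBound_mono n h
    linarith
  · have := hv₁' (by linarith)
    have := isoBound_add_le n (a₀ := a₀) (a₁ := a₁) (b₀ := b₀) (b₁ := b₁)
      (by linarith) (by linarith) hb
    linarith

/-- The subsets of `S` at distance at most `d` from the family `𝒜`. -/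
def cubeNhd {α : Type*} [DecidableEq α] (S : Finset α) (d : ℕ) (𝒜 : Finset (Finset α)) :
    Finset (Finset α) :=
  S.powerset.filter fun y => ∃ x ∈ 𝒜, (symmDiff x y).card ≤ d

lemma card_symmDiff_le_add {α : Type*} [DecidableEq α] (x y z : Finset α) :
    (symmDiff x z).card ≤ (symmDiff x y).card + (symmDiff y z).card :=
  (card_le_card (symmDiff_triangle x y z)).trans (card_union_le _ _)

section Subfamily

variable {α : Type*} [DecidableEq α] {a : α} {S : Finset α} {𝒜 : Finset (Finset α)}

lemma cubeNhd_memberSubfamily_subset (ha : a ∉ S) :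
    cubeNhd S 1 (𝒜.memberSubfamily a) ⊆ (cubeNhd (insert a S) 1 𝒜).memberSubfamily a := by
  intro y
  simp only [cubeNhd, mem_filter, mem_powerset, mem_memberSubfamily]
  rintro ⟨hy, x, ⟨hx, hax⟩, hxy⟩
  have hay : a ∉ y := fun h => ha (hy h)
  refine ⟨⟨insert_subset_insert _ hy, _, hx, ?_⟩, hay⟩
  rwa [show symmDiff (insert a x) (insert a y) = symmDiff x y by
    ext b; by_cases hb : b = a <;> simp [mem_symmDiff, hb, hax, hay]]

lemma cubeNhd_nonMemberSubfamily_subset (ha : a ∉ S) :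
    cubeNhd S 1 (𝒜.nonMemberSubfamily a) ⊆ (cubeNhd (insert a S) 1 𝒜).nonMemberSubfamily a := by
  intro y
  simp only [cubeNhd, mem_filter, mem_powerset, mem_nonMemberSubfamily]
  rintro ⟨hy, x, ⟨hx, -⟩, hxy⟩
  exact ⟨⟨hy.trans (subset_insert _ _), x, hx, hxy⟩, fun h => ha (hy h)⟩

lemma symmDiff_insert_right_of_notMem {x : Finset α} (hx : a ∉ x) :
    symmDiff x (insert a x) = {a} := by
  ext b; by_cases hb : b = a <;> simp [mem_symmDiff, hb, hx]

lemma nonMemberSubfamily_subset_memberSubfamily_cubeNhd (h𝒜 : 𝒜 ⊆ (insert a S).powerset) :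
    𝒜.nonMemberSubfamily a ⊆ (cubeNhd (insert a S) 1 𝒜).memberSubfamily a := by
  intro y
  simp only [cubeNhd, mem_filter, mem_powerset, mem_memberSubfamily, mem_nonMemberSubfamily]
  rintro ⟨hy, hay⟩
  refine ⟨⟨insert_subset (mem_insert_self _ _) (mem_powerset.1 (h𝒜 hy)), y, hy, ?_⟩, hay⟩
  rw [symmDiff_insert_right_of_notMem hay, card_singleton]

lemma memberSubfamily_subset_nonMemberSubfamily_cubeNhd (h𝒜 : 𝒜 ⊆ (insert a S).powerset) :
    𝒜.memberSubfamily a ⊆ (cubeNhd (insert a S) 1 𝒜).nonMemberSubfamily a := by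
  intro y
  simp only [cubeNhd, mem_filter, mem_powerset, mem_memberSubfamily, mem_nonMemberSubfamily]
  rintro ⟨hy, hay⟩
  refine ⟨⟨(subset_insert _ _).trans (mem_powerset.1 (h𝒜 hy)), _, hy, ?_⟩, hay⟩
  rw [symmDiff_comm, symmDiff_insert_right_of_notMem hay, card_singleton]

lemma memberSubfamily_subset_powerset (h𝒜 : 𝒜 ⊆ (insert a S).powerset) :
    𝒜.memberSubfamily a ⊆ S.powerset := by
  intro y hy
  rw [mem_memberSubfamily] at hy
  rw [mem_powerset]
  exact (insert_subset_insert_iff hy.2).1 (mem_powerset.1 (h𝒜 hy.1))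

lemma nonMemberSubfamily_subset_powerset (h𝒜 : 𝒜 ⊆ (insert a S).powerset) :
    𝒜.nonMemberSubfamily a ⊆ S.powerset := by
  intro y hy
  rw [mem_nonMemberSubfamily] at hy
  rw [mem_powerset]
  exact (subset_insert_iff_of_notMem hy.2).1 (mem_powerset.1 (h𝒜 hy.1))

end Subfamily

/-- The vertex-isoperimetric inequality. -/
theorem isoBound_le_card_cubeNhd {α : Type*} [DecidableEq α] (S : Finset α)
    (𝒜 : Finset (Finset α)) (h𝒜 : 𝒜 ⊆ S.powerset) (hne : 𝒜.Nonempty) :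
    isoBound S.card 𝒜.card ≤ (cubeNhd S 1 𝒜).card := by
  induction S using Finset.induction_on generalizing 𝒜 with
  | empty =>
    obtain ⟨x, hx⟩ := hne
    have hpos : 0 < (cubeNhd ∅ 1 𝒜).card :=
      card_pos.2 ⟨x, mem_filter.2 ⟨h𝒜 hx, x, hx, by simp⟩⟩
    have : (1 : ℝ) ≤ (cubeNhd ∅ 1 𝒜).card := by exact_mod_cast hpos
    simpa [isoBound, isoLine, ballCard] using this
  | insert a S ha ih =>
    rw [card_insert_of_notMem ha]
    have hbound : ∀ ℬ : Finset (Finset α), ℬ ⊆ S.powerset → ∀ 𝒞 : Finset (Finset α),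
        cubeNhd S 1 ℬ ⊆ 𝒞 → (0 : ℝ) < ℬ.card → isoBound S.card ℬ.card ≤ 𝒞.card := by
      intro ℬ hℬ 𝒞 hsub hpos
      refine (ih ℬ hℬ (card_pos.1 (by exact_mod_cast hpos))).trans ?_
      exact_mod_cast card_le_card hsub
    have hm := hbound _ (memberSubfamily_subset_powerset h𝒜) _
      (cubeNhd_memberSubfamily_subset ha)
    have hn := hbound _ (nonMemberSubfamily_subset_powerset h𝒜) _
      (cubeNhd_nonMemberSubfamily_subset ha)
    have hm' : ((𝒜.memberSubfamily a).card : ℝ) ≤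
        ((cubeNhd (insert a S) 1 𝒜).nonMemberSubfamily a).card := Nat.cast_le.2
      (card_le_card (memberSubfamily_subset_nonMemberSubfamily_cubeNhd h𝒜))
    have hn' : ((𝒜.nonMemberSubfamily a).card : ℝ) ≤
        ((cubeNhd (insert a S) 1 𝒜).memberSubfamily a).card := Nat.cast_le.2
      (card_le_card (nonMemberSubfamily_subset_memberSubfamily_cubeNhd h𝒜))
    have hcard : ((𝒜.memberSubfamily a).card : ℝ) + (𝒜.nonMemberSubfamily a).card = 𝒜.card := by
      exact_mod_cast card_memberSubfamily_add_card_nonMemberSubfamily a 𝒜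
    have hcard' : (((cubeNhd (insert a S) 1 𝒜).memberSubfamily a).card : ℝ) +
        ((cubeNhd (insert a S) 1 𝒜).nonMemberSubfamily a).card =
          (cubeNhd (insert a S) 1 𝒜).card := by
      exact_mod_cast card_memberSubfamily_add_card_nonMemberSubfamily a _
    have h1 : (1 : ℝ) ≤ 𝒜.card := by exact_mod_cast card_pos.2 hne
    have h2 : (𝒜.card : ℝ) ≤ 2 ^ (S.card + 1) := by
      have := card_le_card h𝒜
      rw [card_powerset, card_insert_of_notMem ha] at this
      exact_mod_cast this
    rw [← hcard] at h1 h2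
    rw [← hcard, ← hcard']
    rcases le_total ((𝒜.nonMemberSubfamily a).card : ℝ) (𝒜.memberSubfamily a).card with h | h
    · exact isoBound_succ_le h h1 h2 (hm (by linarith)) hm' hn
    · rw [add_comm] at h1 h2
      have := isoBound_succ_le h h1 h2 (hn (by linarith)) hn' hm
      rw [add_comm ((𝒜.memberSubfamily a).card : ℝ)]
      linarith

lemma cubeNhd_cubeNhd_subset {α : Type*} [DecidableEq α] (S : Finset α) (d : ℕ)
    (𝒜 : Finset (Finset α)) : cubeNhd S 1 (cubeNhd S d 𝒜) ⊆ cubeNhd S (d + 1) 𝒜 := by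
  intro z hz
  obtain ⟨hz, y, hy, hyz⟩ := mem_filter.1 hz
  obtain ⟨-, x, hx, hxy⟩ := mem_filter.1 hy
  exact mem_filter.2 ⟨hz, x, hx, (card_symmDiff_le_add x y z).trans (add_le_add hxy hyz)⟩

/-- A set at least as large as a Hamming ball has neighborhoods at least as large. -/
theorem ballCard_le_card_cubeNhd {α : Type*} [DecidableEq α] (S : Finset α) (t d : ℕ)
    (𝒜 : Finset (Finset α)) (h𝒜 : 𝒜 ⊆ S.powerset) (ht : ballCard S.card (t + 1) ≤ 𝒜.card) :
    ballCard S.card (t + d + 1) ≤ (cubeNhd S d 𝒜).card := by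
  have hpos : ∀ j, 0 < ballCard S.card (j + 1) := fun j =>
    sum_pos' (fun _ _ => Nat.cast_nonneg _) ⟨0, by simp, by simp⟩
  induction d with
  | zero =>
    refine ht.trans (Nat.cast_le.2 (card_le_card fun x hx => ?_))
    exact mem_filter.2 ⟨h𝒜 hx, x, hx, by simp⟩
  | succ d ih =>
    have hne : (cubeNhd S d 𝒜).Nonempty := by
      rw [← card_pos]
      exact_mod_cast (hpos _).trans_le ih
    calc ballCard S.card (t + d + 1 + 1)
        ≤ isoBound S.card (ballCard S.card (t + d + 1)) := ballCard_succ_le_isoBound _ _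
      _ ≤ isoBound S.card (cubeNhd S d 𝒜).card := isoBound_mono _ ih
      _ ≤ (cubeNhd S 1 (cubeNhd S d 𝒜)).card :=
          isoBound_le_card_cubeNhd S _ (filter_subset _ _) hne
      _ ≤ (cubeNhd S (d + 1) 𝒜).card := by
          exact_mod_cast card_le_card (cubeNhd_cubeNhd_subset S d 𝒜)

/-- If all distances between `A` and `B` are at most `p`, then the antipodes of `B` avoid the
`(n - p - 1)`-neighborhood of `A`. -/
lemma card_cubeNhd_add_card_le {n p : ℕ} (hp : p < n) (A B : Finset (Finset (Fin n)))
    (hAB : ∀ x ∈ A, ∀ y ∈ B, (symmDiff x y).card ≤ p) :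
    (cubeNhd univ (n - p - 1) A).card + B.card ≤ 2 ^ n := by
  rw [← card_image_of_injective B compl_injective, ← card_union_of_disjoint]
  · exact (card_le_univ _).trans (by simp)
  · rw [disjoint_left]
    intro z hz hz'
    obtain ⟨y, hy, rfl⟩ := mem_image.1 hz'
    obtain ⟨-, x, hx, hxy⟩ := mem_filter.1 hz
    have h := hAB x hx y hy
    have htri := card_symmDiff_le_add y x yᶜ
    rw [symmDiff_compl_self, top_eq_univ, card_univ, Fintype.card_fin, symmDiff_comm y x] at htri
    omega

/-- In a b-coloring with `k` colors there are `k` vertices, all of which are equal or adjacent to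
each of the at least `2 * k - |V|` vertices that are alone in their color class. -/
lemma HasBColoring.exists_dominating {V : Type*} [Fintype V] [DecidableEq V] {G : SimpleGraph V}
    {k : ℕ} (h : HasBColoring G k) :
    ∃ A B : Finset V, B.card = k ∧ 2 * k ≤ Fintype.card V + A.card ∧
      ∀ x ∈ A, ∀ y ∈ B, x = y ∨ G.Adj y x := by
  obtain ⟨c, -, hb⟩ := h
  choose b hbc hbw using hb
  have hinj : Function.Injective b := fun i j hij => by rw [← hbc i, hij, hbc]
  let T : Finset (Fin k) := univ.filter fun i => (univ.filter fun v => c v = i).card = 1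
  refine ⟨T.image b, univ.image b, ?_, ?_, ?_⟩
  · simp [card_image_of_injective _ hinj]
  · rw [card_image_of_injective _ hinj, card_filter, ← card_univ,
      card_eq_sum_card_fiberwise (f := c) (t := univ) (by simp), ← sum_add_distrib]
    calc 2 * k = ∑ _i : Fin k, 2 := by simp [mul_comm]
      _ ≤ _ := sum_le_sum fun i _ => by
        have : 0 < (univ.filter fun v => c v = i).card := card_pos.2 ⟨b i, by simp [hbc]⟩
        split_ifs <;> omega
  · intro x hx y hy
    obtain ⟨i, hi, rfl⟩ := mem_image.1 hx
    obtain ⟨j, -, rfl⟩ := mem_image.1 hy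
    by_cases hij : i = j
    · exact Or.inl (by rw [hij])
    · obtain ⟨w, hw, hcw⟩ := hbw j i hij
      obtain rfl : b i = w := card_le_one.1 (mem_filter.1 hi).2.le _ (by simp [hbc]) _
        (by simp [hcw])
      exact Or.inr hw

/-- For odd `n ≥ 5` and `(n+1)/2 ≤ p ≤ n-2`, with `r = ∑_{i=0}^{p-(n-1)/2} C(n,i)`,
`Q_n^p` admits no b-coloring with more than `2^{n-1} + ⌈r/2⌉ - 1` colors. -/
theorem stmt8 (n p : ℕ) (hodd : Odd n) (hn : 5 ≤ n)
    (hp1 : (n + 1) / 2 ≤ p) (hp2 : p ≤ n - 2)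
    (r : ℕ) (hr : r = ∑ i ∈ Finset.range (p - (n - 1) / 2 + 1), Nat.choose n i)
    (k : ℕ) (h : HasBColoring (cubePow n p) k) :
    k ≤ 2 ^ (n - 1) + (r + 1) / 2 - 1 := by
  obtain ⟨m, rfl⟩ := hodd
  obtain ⟨A, B, hB, hA, hAB⟩ := h.exists_dominating
  have hr1 : 1 ≤ r := by
    rw [hr, sum_range_succ']
    simp
  have hpow : 2 ^ (2 * m + 1) = 2 * 4 ^ m := by rw [pow_succ, pow_mul, mul_comm]; norm_num
  rw [Fintype.card_finset, Fintype.card_fin, hpow] at hA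
  rw [Nat.add_sub_cancel, pow_mul, show 2 ^ 2 = 4 by norm_num]
  by_cases hAr : A.card < r
  · omega
  have hdist : ∀ x ∈ A, ∀ y ∈ B, (symmDiff x y).card ≤ p := by
    intro x hx y hy
    rcases hAB x hx y hy with rfl | hadj
    · simp
    · rw [symmDiff_comm]
      exact hadj.2
  have hcard := card_cubeNhd_add_card_le (by omega) A B hdist
  have hball : ballCard (2 * m + 1) (p - m + 1) ≤ A.card := by
    rw [show (2 * m + 1 - 1) / 2 = m by omega] at hr
    unfold ballCard
    exact_mod_cast hr ▸ not_lt.1 hAr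
  have hnhd := ballCard_le_card_cubeNhd univ (p - m) (2 * m + 1 - p - 1) A
    (by simp) (by simpa using hball)
  rw [card_univ, Fintype.card_fin, show p - m + (2 * m + 1 - p - 1) + 1 = m + 1 by omega,
    ballCard, ← Nat.cast_sum, Nat.sum_range_choose_halfway, Nat.cast_le] at hnhd
  rw [hpow] at hcard
  omega
end
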